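/- arXiv:1702.06447 — 2 statements merged into one kernel-verified Lean document; each statement's English description precedes it below -/
import Mathlib

section
/- Let F be a C₁-field, A a finite-dimensional F-algebra, K/F a finite Galois extension with Galois group G, and M a finitely generated A_K-module. Let G_M = {g ∈ G : ᵍM ≅ M}, where ᵍM denotes the twist of M by g. Then the fixed field K^{G_M} is the minimal field of definition of M. -/
open TensorProduct

/-- `F` is a `C₁`-field. -/
def IsC1Field (F : Type) [Field F] : Prop :=
  ∀ (n d : ℕ) (f : MvPolynomial (Fin n) F), f.IsHomogeneous d → 0 < d → d < n →
    ∃ x : Fin n → F, x ≠ 0 ∧ MvPolynomial.eval x f = 0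

/-- `M` descends to the intermediate field `E` of `K/F`. -/
def DescendsTo (F K A : Type) [Field F] [Field K] [Algebra F K]
    [Ring A] [Algebra F A]
    (M : Type) [AddCommGroup M] [Module F M] [Module K M] [Module A M]
    [IsScalarTower F K M] [IsScalarTower F A M] [SMulCommClass K A M]
    (E : IntermediateField F K) : Prop :=
  ∃ N : Submodule E M, (∀ (a : A) (x : M), x ∈ N → a • x ∈ N) ∧
    IsBaseChange K N.subtype

/-- `g ∈ Gal(K/F)` stabilizes the isomorphism class of the `A_K`-module `M`, i.e.
`ᵍM ≅ M`: there is an additive, `A`-equivariant, `g`-semilinear automorphism of `M`. -/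
def StabilizesModule (F K A : Type) [Field F] [Field K] [Algebra F K]
    [Ring A] [Algebra F A]
    (M : Type) [AddCommGroup M] [Module F M] [Module K M] [Module A M]
    [IsScalarTower F K M] [IsScalarTower F A M] [SMulCommClass K A M]
    (g : K ≃ₐ[F] K) : Prop :=
  ∃ e : M ≃+ M, (∀ (k : K) (x : M), e (k • x) = g k • e x) ∧
    (∀ (a : A) (x : M), e (a • x) = a • e x)


/-- Top homogeneous components multiply. -/
lemma homogComp_top_mul {n : ℕ} {F : Type} [Field F] (f g : MvPolynomial (Fin n) F) :
    MvPolynomial.homogeneousComponent (f.totalDegree + g.totalDegree) (f * g) =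
      MvPolynomial.homogeneousComponent f.totalDegree f *
        MvPolynomial.homogeneousComponent g.totalDegree g := by
  have hfg : f * g = ∑ i ∈ Finset.range (f.totalDegree + 1),
      ∑ j ∈ Finset.range (g.totalDegree + 1),
      MvPolynomial.homogeneousComponent i f * MvPolynomial.homogeneousComponent j g := by
    rw [← Finset.sum_mul_sum, MvPolynomial.sum_homogeneousComponent,
      MvPolynomial.sum_homogeneousComponent]
  rw [hfg]
  simp only [map_sum]
  have key : ∀ i j, MvPolynomial.homogeneousComponent (f.totalDegree + g.totalDegree)
      (MvPolynomial.homogeneousComponent i f * MvPolynomial.homogeneousComponent j g) =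
      if f.totalDegree + g.totalDegree = i + j then
        (MvPolynomial.homogeneousComponent i f * MvPolynomial.homogeneousComponent j g) else 0 := by
    intro i j
    apply MvPolynomial.homogeneousComponent_of_mem (n := i + j)
    exact (MvPolynomial.homogeneousComponent_isHomogeneous i f).mul
      (MvPolynomial.homogeneousComponent_isHomogeneous j g)
  simp_rw [key]
  rw [Finset.sum_eq_single f.totalDegree, Finset.sum_eq_single g.totalDegree]
  · simp
  · intro j hj hne
    rw [if_neg]; omega
  · intro h; simp at h
  · intro i hi hne
    apply Finset.sum_eq_zero
    intro j hj
    simp only [Finset.mem_range] at hi hj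
    rw [if_neg]; omega
  · intro h; simp at h

section C1
variable {F D : Type} [Field F] [Ring D] [Algebra F D] {n : ℕ} (b : Module.Basis (Fin n) F D)

/-- The generic left multiplication matrix. -/
noncomputable def genMat : Matrix (Fin n) (Fin n) (MvPolynomial (Fin n) F) :=
  ∑ i, (MvPolynomial.X i : MvPolynomial (Fin n) F) •
    (Algebra.leftMulMatrix b (b i)).map MvPolynomial.C

lemma genMat_eval (a : Fin n → F) :
    (genMat b).map (MvPolynomial.eval a) = Algebra.leftMulMatrix b (∑ i, a i • b i) := by
  ext r s
  simp [genMat, Matrix.sum_apply]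

lemma genMat_det_homog : (genMat b).det.IsHomogeneous n := by
  rw [Matrix.det_apply]
  apply MvPolynomial.IsHomogeneous.sum
  intro σ _
  have h : (∏ i, genMat b (σ i) i).IsHomogeneous (∑ i : Fin n, 1) := by
    apply MvPolynomial.IsHomogeneous.prod
    intro i _
    simp only [genMat, Matrix.sum_apply]
    apply MvPolynomial.IsHomogeneous.sum
    intro j _
    simp only [Matrix.smul_apply, Matrix.map_apply, smul_eq_mul]
    rw [mul_comm]
    exact MvPolynomial.isHomogeneous_C_mul_X _ _
  simp only [Finset.sum_const, Finset.card_univ, Fintype.card_fin, smul_eq_mul, mul_one] at h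
  rcases Int.units_eq_one_or (Equiv.Perm.sign σ) with h' | h' <;> rw [h']
  · simpa using h
  · simpa using h.neg

lemma genMat_const : (genMat b).map (MvPolynomial.constantCoeff) = 0 := by
  ext r s
  simp [genMat, Matrix.sum_apply]

lemma const_aux (f g : Polynomial (MvPolynomial (Fin n) F)) (hf : f.Monic)
    (h : f * g = (genMat b).charpoly) (hd : f.natDegree ≠ 0) :
    MvPolynomial.constantCoeff (f.coeff 0) = 0 := by
  have h1 : f.map (MvPolynomial.constantCoeff (R := F) (σ := Fin n)) ∣ Polynomial.X ^ n := by
    have := Matrix.charpoly_map (genMat b) (MvPolynomial.constantCoeff (R := F) (σ := Fin n))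
    rw [genMat_const, ← h, Polynomial.map_mul] at this
    rw [Matrix.charpoly_zero, Fintype.card_fin] at this
    exact ⟨_, this⟩
  rw [dvd_prime_pow Polynomial.prime_X] at h1
  obtain ⟨i, -, hi⟩ := h1
  have h2 := Polynomial.eq_of_monic_of_associated (hf.map _) (Polynomial.monic_X_pow i) hi
  have h3 := congrArg Polynomial.natDegree h2
  rw [hf.natDegree_map, Polynomial.natDegree_X_pow] at h3
  have h4 := congrArg (fun p => Polynomial.coeff p 0) h2
  simp only [Polynomial.coeff_map] at h4
  rw [h4, Polynomial.coeff_X_pow, if_neg (by omega)]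

lemma genMat_charpoly_irreducible (hC1 : IsC1Field F) [Nontrivial D]
    (hD : ∀ x : D, x ≠ 0 → IsUnit x) : Irreducible (genMat b).charpoly := by
  have hn : 0 < n := by
    rcases Nat.eq_zero_or_pos n with rfl | h
    · have := b.repr.toEquiv.subsingleton
      exact (not_subsingleton D ‹_›).elim
    · exact h
  have hdet : ∀ a : Fin n → F, a ≠ 0 → MvPolynomial.eval a (genMat b).det ≠ 0 := by
    intro a ha h0
    have h1 : (Algebra.leftMulMatrix b (∑ i, a i • b i)).det = 0 := by
      rw [← genMat_eval, ← h0, RingHom.map_det]; rfl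
    have h2 : (∑ i, a i • b i) ≠ 0 := by
      intro h
      apply ha
      ext i
      exact Fintype.linearIndependent_iff.1 b.linearIndependent a h i
    have h3 := ((hD _ h2).map (Algebra.leftMulMatrix b))
    rw [Matrix.isUnit_iff_isUnit_det, h1] at h3
    exact not_isUnit_zero h3
  have hdet0 : (genMat b).det ≠ 0 := by
    intro h
    refine hdet (fun _ => 1) ?_ (by rw [h]; simp)
    intro h
    exact one_ne_zero (congrFun h ⟨0, hn⟩)
  rw [(genMat b).charpoly_monic.irreducible_iff_natDegree]
  constructor
  · intro h
    have := Matrix.charpoly_natDegree_eq_dim (genMat b)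
    rw [h] at this
    simp at this
    omega
  intro f g hf hg hfg
  by_contra! hcon
  obtain ⟨hfd, hgd⟩ := hcon
  have cf := const_aux b f g hf hfg hfd
  have cg := const_aux b g f hg (by rw [mul_comm, hfg]) hgd
  have hN : (genMat b).det = (-1) ^ n * (f.coeff 0 * g.coeff 0) := by
    rw [Matrix.det_eq_sign_charpoly_coeff, ← hfg, Polynomial.mul_coeff_zero, Fintype.card_fin]
  have hN' : f.coeff 0 * g.coeff 0 = (-1) ^ n * (genMat b).det := by
    rw [hN, ← mul_assoc, ← mul_pow]; simp
  have hhom : (f.coeff 0 * g.coeff 0).IsHomogeneous n := by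
    rw [hN']
    have := (genMat_det_homog b).C_mul ((-1) ^ n)
    simpa using this
  have hprod : f.coeff 0 * g.coeff 0 ≠ 0 := by
    intro h; rw [h] at hN; exact hdet0 (by simpa using hN)
  have hf0 := left_ne_zero_of_mul hprod
  have hg0 := right_ne_zero_of_mul hprod
  have pos : ∀ p : MvPolynomial (Fin n) F, p ≠ 0 → MvPolynomial.constantCoeff p = 0 →
      0 < p.totalDegree := by
    intro p hp hc
    rw [Nat.pos_iff_ne_zero]
    intro h
    rw [MvPolynomial.totalDegree_eq_zero_iff_eq_C] at h
    rw [MvPolynomial.constantCoeff_eq] at hc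
    rw [hc] at h
    exact hp (by simpa using h)
  have pf := pos _ hf0 cf
  have pg := pos _ hg0 cg
  have hsum := hhom.totalDegree hprod
  rw [MvPolynomial.totalDegree_mul_of_isDomain hf0 hg0] at hsum
  have htop := homogComp_top_mul (f.coeff 0) (g.coeff 0)
  rw [hsum, MvPolynomial.homogeneousComponent_eq_self hhom] at htop
  obtain ⟨a, ha, ha0⟩ := hC1 n _ _
    (MvPolynomial.homogeneousComponent_isHomogeneous (f.coeff 0).totalDegree (f.coeff 0))
    pf (by omega)
  apply hdet a ha
  rw [hN, htop, map_mul, map_mul, ha0]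
  simp

lemma leftMulMatrix_tmul {F D : Type} [Field F] [Ring D] [Algebra F D] {n : ℕ}
    (b : Module.Basis (Fin n) F D) (Φ : Type) [Field Φ] [Algebra F Φ] (d : D) (r s : Fin n) :
    Algebra.leftMulMatrix (Algebra.TensorProduct.basis Φ b) ((1 : Φ) ⊗ₜ[F] d) r s =
      algebraMap F Φ (Algebra.leftMulMatrix b d r s) := by
  rw [Algebra.leftMulMatrix_eq_repr_mul, Algebra.leftMulMatrix_eq_repr_mul]
  simp [Algebra.TensorProduct.basis_repr_tmul]

lemma comm_of_c1_aux {F D : Type} [Field F] [Ring D] [Algebra F D] {n : ℕ}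
    (b : Module.Basis (Fin n) F D) (hC1 : IsC1Field F) [Nontrivial D]
    (hD : ∀ x : D, x ≠ 0 → IsUnit x) (x y : D) : x * y = y * x := by
  classical
  let R := MvPolynomial (Fin n) F
  let Φ := FractionRing R
  have hirr := genMat_charpoly_irreducible b hC1 hD
  rw [(genMat b).charpoly_monic.irreducible_iff_irreducible_map_fraction_map (K := Φ),
    ← Matrix.charpoly_map] at hirr
  let DΦ := Φ ⊗[F] D
  let bΦ : Module.Basis (Fin n) Φ DΦ := Algebra.TensorProduct.basis Φ b
  let ξ : DΦ := ∑ i, (algebraMap R Φ (MvPolynomial.X i)) • ((1 : Φ) ⊗ₜ[F] b i)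
  have hξ : Algebra.leftMulMatrix bΦ ξ = (genMat b).map (algebraMap R Φ) := by
    ext r s
    simp only [ξ, map_sum, Matrix.sum_apply, genMat, map_smul, Matrix.smul_apply,
      Matrix.map_apply, smul_eq_mul, map_mul]
    refine Finset.sum_congr rfl fun i _ => ?_
    congr 1
    refine (leftMulMatrix_tmul b Φ (b i) r s).trans ?_
    rw [IsScalarTower.algebraMap_apply F R Φ]
    rfl
  rw [← hξ] at hirr
  have hann : Polynomial.aeval ξ (Algebra.leftMulMatrix bΦ ξ).charpoly = 0 := by
    apply Algebra.leftMulMatrix_injective bΦ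
    rw [← Polynomial.aeval_algHom_apply, Matrix.aeval_self_charpoly, map_zero]
  have hξint : IsIntegral Φ ξ := ⟨_, Matrix.charpoly_monic _, hann⟩
  have : Module.Finite Φ DΦ := Module.Finite.of_basis bΦ
  have : Nontrivial DΦ := by
    have : Nonempty (Fin n) := by
      by_contra h
      rw [not_nonempty_iff] at h
      have := b.repr.toEquiv.subsingleton
      exact (not_subsingleton D ‹_›).elim
    exact ⟨bΦ this.some, 0, bΦ.ne_zero _⟩
  have hmin : (minpoly Φ ξ) = (Algebra.leftMulMatrix bΦ ξ).charpoly := by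
    have hd := minpoly.dvd Φ ξ hann
    have := (hirr.dvd_iff.1 hd).resolve_left (minpoly.not_isUnit Φ ξ)
    exact (Polynomial.eq_of_monic_of_associated (Matrix.charpoly_monic _) (minpoly.monic hξint)
      this).symm
  have hdeg : (minpoly Φ ξ).natDegree = n := by
    rw [hmin, Matrix.charpoly_natDegree_eq_dim, Fintype.card_fin]
  have hli := linearIndependent_pow (K := Φ) ξ
  have hspan := hli.span_eq_top_of_card_eq_finrank' (by
    rw [Fintype.card_fin, hdeg, Module.finrank_eq_card_basis bΦ, Fintype.card_fin])
  have hcomm1 : ∀ z : DΦ, Commute ξ z := by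
    intro z
    have hz : z ∈ Submodule.span Φ (Set.range fun i : Fin (minpoly Φ ξ).natDegree => ξ ^ (i : ℕ)) :=
      hspan ▸ Submodule.mem_top
    induction hz using Submodule.span_induction with
    | mem x h => obtain ⟨i, rfl⟩ := h; exact (Commute.refl ξ).pow_right _
    | zero => exact Commute.zero_right _
    | add x y _ _ hx hy => exact hx.add_right hy
    | smul a x _ hx => exact hx.smul_right a
  have hcomm : ∀ z w : DΦ, Commute w z := by
    intro z w
    have hz : z ∈ Submodule.span Φ (Set.range fun i : Fin (minpoly Φ ξ).natDegree => ξ ^ (i : ℕ)) :=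
      hspan ▸ Submodule.mem_top
    induction hz using Submodule.span_induction with
    | mem x h => obtain ⟨i, rfl⟩ := h; exact (hcomm1 w).symm.pow_right _
    | zero => exact Commute.zero_right _
    | add x y _ _ hx hy => exact hx.add_right hy
    | smul a x _ hx => exact hx.smul_right a
  have hinj : Function.Injective (Algebra.TensorProduct.includeRight : D →ₐ[F] DΦ) :=
    Algebra.TensorProduct.includeRight_injective (algebraMap F Φ).injective
  apply hinj
  rw [map_mul, map_mul]
  exact hcomm _ _

end C1

lemma comm_of_c1 {F D : Type} [Field F] [Ring D] [Algebra F D] [Module.Finite F D]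
    (hC1 : IsC1Field F) [Nontrivial D]
    (hD : ∀ x : D, x ≠ 0 → IsUnit x) (x y : D) : x * y = y * x :=
  comm_of_c1_aux (Module.finBasis F D) hC1 hD x y

/-- Ring-theoretic conditions satisfied by rings that are reduced commutative artinian
modulo a nilpotent ideal. -/
def GoodRing (S : Type) [Ring S] : Prop :=
  (∀ (ι : Type) [Fintype ι] (σ : ι → ι → S), ∑ i, σ i i = 1 →
    ∃ s : ι → S, IsUnit (∑ i, ∑ j, s i * σ i j * s j)) ∧
  (∀ a c b : S, a * c + b = 1 → ∃ t, IsUnit (a + b * t))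

lemma GoodRing.of_surj {S T : Type} [Ring S] [Ring T] (f : S →+* T)
    (hf : Function.Surjective f) (h : GoodRing S) : GoodRing T := by
  classical
  refine ⟨?_, ?_⟩
  · intro ι _ σ hσ
    rcases isEmpty_or_nonempty ι with hι | ⟨⟨i0⟩⟩
    · simp only [Finset.univ_eq_empty, Finset.sum_empty] at hσ
      have : Subsingleton T := subsingleton_of_zero_eq_one hσ
      exact ⟨fun _ => 0, isUnit_of_subsingleton _⟩
    · choose σ' hσ' using fun i j => hf (σ i j)
      let k : S := ∑ i, σ' i i - 1
      have hk : f k = 0 := by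
        simp [k, hσ', hσ]
      obtain ⟨s, hs⟩ := h.1 ι (fun i j => σ' i j - if i = i0 ∧ j = i0 then k else 0) (by
        simp [Finset.sum_sub_distrib, k])
      refine ⟨fun i => f (s i), ?_⟩
      convert hs.map f using 1
      simp only [map_sum, map_mul, map_sub, hσ']
      refine Finset.sum_congr rfl fun i _ => Finset.sum_congr rfl fun j _ => ?_
      split_ifs <;> simp [hk]
  · intro a c b hab
    obtain ⟨a, rfl⟩ := hf a
    obtain ⟨c, rfl⟩ := hf c
    obtain ⟨t, ht⟩ := h.2 a c (1 - a * c) (by abel)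
    refine ⟨f t, ?_⟩
    have hb : b = f (1 - a * c) := by
      rw [map_sub, map_mul, map_one, ← hab]; abel
    rw [hb, ← map_mul, ← map_add]
    exact ht.map f

lemma GoodRing.of_local {S T : Type} [Ring S] [Ring T] (f : S →+* T)
    (hf : Function.Surjective f) (hl : ∀ x, IsUnit (f x) → IsUnit x) (h : GoodRing T) :
    GoodRing S := by
  refine ⟨?_, ?_⟩
  · intro ι _ σ hσ
    obtain ⟨s, hs⟩ := h.1 ι (fun i j => f (σ i j)) (by rw [← map_sum, hσ, map_one])
    choose s' hs' using fun i => hf (s i)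
    refine ⟨s', hl _ ?_⟩
    simpa [hs'] using hs
  · intro a c b hab
    obtain ⟨t, ht⟩ := h.2 (f a) (f c) (f b) (by rw [← map_mul, ← map_add, hab, map_one])
    obtain ⟨t, rfl⟩ := hf t
    exact ⟨t, hl _ (by simpa using ht)⟩

lemma GoodRing.of_comm (C : Type) [CommRing C] [IsArtinianRing C] [IsReduced C] :
    GoodRing C := by
  classical
  let e := IsArtinianRing.equivPi C
  have hu : ∀ x : C, (∀ m : MaximalSpectrum C, x ∉ m.asIdeal) → IsUnit x := by
    intro x hx
    by_contra h
    obtain ⟨m, hm, hxm⟩ := exists_max_ideal_of_mem_nonunits h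
    exact hx ⟨m, hm⟩ hxm
  have he : ∀ (v : MaximalSpectrum C → C), ∃ c : C, ∀ m, Ideal.Quotient.mk m.asIdeal c =
      Ideal.Quotient.mk m.asIdeal (v m) := by
    intro v
    obtain ⟨c, hc⟩ := e.surjective (fun m => Ideal.Quotient.mk m.asIdeal (v m))
    exact ⟨c, fun m => congrFun hc m⟩
  refine ⟨?_, ?_⟩
  · intro ι _ σ hσ
    have h1 : ∀ m : MaximalSpectrum C, ∃ i, σ i i ∉ m.asIdeal := by
      intro m
      by_contra! hcon
      have := m.asIdeal.sum_mem (t := Finset.univ) (fun i _ => hcon i)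
      rw [hσ] at this
      exact m.isMaximal.ne_top ((Ideal.eq_top_iff_one _).2 this)
    choose i hi using h1
    choose s hs using fun j => he (fun m => if i m = j then 1 else 0)
    refine ⟨s, hu _ fun m hm => hi m ?_⟩
    rw [← Ideal.Quotient.eq_zero_iff_mem] at hm ⊢
    rw [← hm]
    simp [hs, apply_ite (Ideal.Quotient.mk m.asIdeal)]
  · intro a c b hab
    obtain ⟨t, ht⟩ := he (fun m => if a ∈ m.asIdeal then 1 else 0)
    refine ⟨t, hu _ fun m hm => ?_⟩
    rw [← Ideal.Quotient.eq_zero_iff_mem, map_add, map_mul, ht] at hm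
    have hab' := congrArg (Ideal.Quotient.mk m.asIdeal) hab
    have := m.isMaximal
    by_cases ha : a ∈ m.asIdeal
    · rw [if_pos ha] at hm
      rw [map_add, map_mul, Ideal.Quotient.eq_zero_iff_mem.2 ha] at hab'
      rw [Ideal.Quotient.eq_zero_iff_mem.2 ha] at hm
      simp only [map_one, mul_one, zero_add, zero_mul] at hm hab'
      rw [hm] at hab'
      exact zero_ne_one hab'
    · rw [if_neg ha] at hm
      simp only [map_zero, mul_zero, add_zero] at hm
      exact ha (Ideal.Quotient.eq_zero_iff_mem.1 hm)

/-- All finite dimensional division algebras over `E` are commutative. -/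
def DivComm (E : Type) [Field E] : Prop :=
  ∀ (D : Type) [Ring D] [Algebra E D] [Module.Finite E D] [Nontrivial D],
    (∀ x : D, x ≠ 0 → IsUnit x) → ∀ x y : D, x * y = y * x

lemma good_comm_tensor (E K D : Type) [Field E] [Field K] [Algebra E K] [FiniteDimensional E K]
    [Algebra.IsSeparable E K] [CommRing D] [Algebra E D] [Module.Finite E D] [Nontrivial D]
    (hD : ∀ x : D, x ≠ 0 → IsUnit x) : GoodRing (D ⊗[E] K) := by
  have hfield : IsField D := ⟨⟨0, 1, zero_ne_one⟩, mul_comm, fun h => (hD _ h).exists_right_inv⟩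
  let : Field D := hfield.toField
  have : Algebra.FormallyUnramified E K := Algebra.FormallyUnramified.of_isSeparable E K
  have : IsReduced (D ⊗[E] K) := Algebra.FormallyUnramified.isReduced_of_field D (D ⊗[E] K)
  have : IsArtinianRing (D ⊗[E] K) := IsArtinianRing.of_finite D _
  exact GoodRing.of_comm _

lemma good_tensor (E K S : Type) [Field E] [Field K] [Algebra E K] [FiniteDimensional E K]
    [Algebra.IsSeparable E K] (hE : DivComm E)
    [Ring S] [Algebra E S] [Module.Finite E S] [Nontrivial S]
    (hS : ∀ x : S, IsNilpotent x ∨ IsUnit x) : GoodRing (S ⊗[E] K) := by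
  have : IsArtinianRing S := IsArtinianRing.of_finite E S
  let J := Ring.jacobson S
  have hnil : IsNilpotent J := IsSemiprimaryRing.isNilpotent
  have hJ : ∀ x : S, x ∉ J → IsUnit x := by
    intro x hx
    by_contra hux
    apply hx
    have hxn := (hS x).resolve_right hux
    simp only [J, Ring.jacobson_eq_sInf_isMaximal, Ideal.mem_sInf]
    intro I hI
    by_contra hxI
    have hI' : I.IsMaximal := hI
    obtain ⟨y, i, hi, hyi⟩ := hI'.exists_inv hxI
    rcases hS (y * x) with h | h
    · have h2 := h.isUnit_one_sub
      rw [← hyi, add_sub_cancel_left] at h2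
      exact hI'.ne_top (Ideal.eq_top_of_isUnit_mem _ hi h2)
    · obtain ⟨u, hu⟩ := h.exists_left_inv
      rw [← mul_assoc] at hu
      obtain ⟨k, hk⟩ := hxn
      have hr := (isLeftRegular_of_mul_eq_one hu).pow k
      rw [hk] at hr
      exact one_ne_zero (hr (show (0 : S) * 1 = 0 * 0 by simp))
  let D := S ⧸ J
  have hJ1 : J ≠ ⊤ := (Ring.jacobson_lt_top S).ne
  have : Nontrivial D := Ideal.Quotient.nontrivial_iff.2 hJ1
  have hD : ∀ x : D, x ≠ 0 → IsUnit x := by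
    intro x hx
    obtain ⟨x, rfl⟩ := Ideal.Quotient.mk_surjective x
    refine (hJ x ?_).map _
    intro h
    exact hx (Ideal.Quotient.eq_zero_iff_mem.2 h)
  have hmul := hE D hD
  let : CommRing D := { (inferInstance : Ring D) with mul_comm := hmul }
  have hgood : GoodRing (D ⊗[E] K) := good_comm_tensor E K D hD
  let q : S →ₐ[E] D := Ideal.Quotient.mkₐ E J
  have hq : Function.Surjective q := Ideal.Quotient.mkₐ_surjective E J
  let π : S ⊗[E] K →ₐ[E] D ⊗[E] K := Algebra.TensorProduct.map q (AlgHom.id E K)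
  have hπ : Function.Surjective π := TensorProduct.map_surjective hq Function.surjective_id
  refine GoodRing.of_local π.toRingHom hπ ?_ hgood
  let V : ℕ → Submodule E (S ⊗[E] K) := fun m =>
    Submodule.span E {z | ∃ j ∈ J ^ m, ∃ k : K, z = j ⊗ₜ[E] k}
  have hV1 : ∀ z, π z = 0 → z ∈ V 1 := by
    intro z hz
    let ι : (J.restrictScalars E) →ₗ[E] S := (J.restrictScalars E).subtype
    have hex : Function.Exact ι q.toLinearMap := by
      intro x
      constructor
      · intro h
        have : x ∈ J := Ideal.Quotient.eq_zero_iff_mem.1 h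
        exact ⟨⟨x, this⟩, rfl⟩
      · rintro ⟨⟨x, hx⟩, rfl⟩
        exact Ideal.Quotient.eq_zero_iff_mem.2 hx
    have hex' := rTensor_exact K hex hq
    obtain ⟨w, rfl⟩ := (hex' z).1 hz
    induction w using TensorProduct.induction_on with
    | zero => simp
    | tmul j k =>
      refine Submodule.subset_span ⟨j, ?_, k, rfl⟩
      rw [Submodule.pow_one]; exact j.2
    | add x y hx hy =>
      rw [map_add]
      refine add_mem (hx ?_) (hy ?_)
      · exact (hex' _).2 ⟨x, rfl⟩
      · exact (hex' _).2 ⟨y, rfl⟩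
  have hVmul : ∀ m, ∀ x ∈ V 1, ∀ y ∈ V m, x * y ∈ V (m + 1) := by
    intro m x hx y hy
    induction hx using Submodule.span_induction with
    | zero => simp
    | add x x' _ _ hx hx' => rw [add_mul]; exact add_mem hx hx'
    | smul a x _ hx => rw [smul_mul_assoc]; exact Submodule.smul_mem _ _ hx
    | mem x h =>
      obtain ⟨j, hj, k, rfl⟩ := h
      induction hy using Submodule.span_induction with
      | zero => simp
      | add x x' _ _ hx hx' => rw [mul_add]; exact add_mem hx hx'
      | smul a x _ hx => rw [mul_smul_comm]; exact Submodule.smul_mem _ _ hx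
      | mem y h' =>
        obtain ⟨j', hj', k', rfl⟩ := h'
        refine Submodule.subset_span ⟨j * j', ?_, k * k', by simp⟩
        rw [Submodule.pow_one] at hj
        rw [Ideal.IsTwoSided.pow_succ]
        exact Ideal.mul_mem_mul hj hj'
  have hker : ∀ z, π z = 0 → IsNilpotent z := by
    intro z hz
    have hz1 := hV1 z hz
    have hpow : ∀ m, z ^ (m + 1) ∈ V (m + 1) := by
      intro m
      induction m with
      | zero => simpa using hz1
      | succ m ih => rw [pow_succ']; exact hVmul _ _ hz1 _ ih
    obtain ⟨m, hm⟩ := hnil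
    refine ⟨m + 1, ?_⟩
    have h0 : J ^ (m + 1) = 0 := by
      rw [Submodule.pow_succ, hm]; exact Submodule.bot_mul _
    have h1 := hpow m
    have h2 : V (m + 1) = ⊥ := by
      rw [Submodule.span_eq_bot]
      rintro _ ⟨j, hj, k, rfl⟩
      rw [h0] at hj
      rw [(Submodule.mem_bot S).1 hj, TensorProduct.zero_tmul]
    rw [h2] at h1
    exact (Submodule.mem_bot E).1 h1
  have hone : ∀ z, π z = 1 → IsUnit z := by
    intro z hz
    have := (hker (1 - z) (by rw [map_sub, hz, map_one, sub_self])).isUnit_one_sub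
    simpa using this
  intro x hx
  obtain ⟨y, hy⟩ := hx.exists_right_inv
  obtain ⟨y', hy'⟩ := hx.exists_left_inv
  obtain ⟨y, rfl⟩ := hπ y
  obtain ⟨y', rfl⟩ := hπ y'
  have h1 := hone (x * y) (by rw [map_mul]; exact hy)
  have h2 := hone (y' * x) (by rw [map_mul]; exact hy')
  obtain ⟨w, hw⟩ := h1.exists_right_inv
  obtain ⟨w', hw'⟩ := h2.exists_left_inv
  rw [mul_assoc] at hw
  rw [← mul_assoc] at hw'
  rw [isUnit_iff_exists_and_exists]
  exact ⟨⟨_, hw⟩, ⟨_, hw'⟩⟩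

/-- The ring of endomorphisms commuting with a family of operators. -/
abbrev Comm {k A V : Type} [Field k] [AddCommGroup V] [Module k V] (ρ : A → Module.End k V) :
    Subalgebra k (Module.End k V) := Subalgebra.centralizer k (Set.range ρ)

/-- The ring structure on the commutant. -/
instance instRingComm {k A V : Type} [Field k] [AddCommGroup V] [Module k V]
    (ρ : A → Module.End k V) : Ring (Comm ρ) := Subalgebra.toRing (Comm ρ)

lemma mem_Comm {k A V : Type} [Field k] [AddCommGroup V] [Module k V] {ρ : A → Module.End k V}
    {f : Module.End k V} : f ∈ Comm ρ ↔ ∀ a x, f (ρ a x) = ρ a (f x) := by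
  rw [Subalgebra.mem_centralizer_iff]
  constructor
  · intro h a x
    exact (LinearMap.congr_fun (h (ρ a) ⟨a, rfl⟩) x).symm
  · rintro h _ ⟨a, rfl⟩
    ext x
    exact (h a x).symm

section BC
variable {E K A N : Type} [Field E] [Field K] [Algebra E K] [FiniteDimensional E K]
  [AddCommGroup N] [Module E N]

/-- Base change of a family of operators. -/
abbrev bcOp (K : Type) [Field K] [Algebra E K] (ρ : A → Module.End E N) :
    A → Module.End K (K ⊗[E] N) := fun a => (ρ a).baseChange K

lemma good_Comm_baseChange (ρ : A → Module.End E N)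
    (h : GoodRing (Comm ρ ⊗[E] K)) :
    GoodRing (Comm (bcOp K ρ)) := by
  classical
  let ρK : A → Module.End K (K ⊗[E] N) := bcOp K ρ
  let T := Comm ρK
  let f1 : Comm ρ →ₐ[E] T :=
    AlgHom.codRestrict (R := E) (B := Module.End K (K ⊗[E] N))
      ((Module.End.baseChangeHom E K N).comp (Comm ρ).val) (T.restrictScalars E) (by
      intro s
      change _ ∈ T
      rw [mem_Comm]
      intro a x
      have hs := mem_Comm.1 s.2 a
      induction x using TensorProduct.induction_on with
      | zero => simp
      | tmul k y =>
        change k ⊗ₜ[E] _ = k ⊗ₜ[E] _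
        exact congrArg _ (hs y)
      | add x y hx hy => simp only [map_add, hx, hy])
  let f2 : K →ₐ[E] T := (Algebra.ofId K T).restrictScalars E
  let Ψ : Comm ρ ⊗[E] K →ₐ[E] T := Algebra.TensorProduct.lift f1 f2
    (fun x y => (Algebra.commutes y (f1 x)).symm)
  refine GoodRing.of_surj (S := Comm ρ ⊗[E] K) (T := Comm (bcOp K ρ)) Ψ.toRingHom ?_ h
  intro f
  let b := Module.finBasis E K
  let c : ∀ i, K ⊗[E] N →ₗ[E] N := fun i =>
    (TensorProduct.lid E N).toLinearMap ∘ₗ (LinearMap.rTensor N (b.coord i))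
  have hc : ∀ i k y, c i (k ⊗ₜ y) = b.repr k i • y := by
    intro i k y; simp [c]
  have hz : ∀ z : K ⊗[E] N, z = ∑ i, b i ⊗ₜ[E] c i z := by
    intro z
    induction z using TensorProduct.induction_on with
    | zero => simp
    | tmul k y =>
      simp only [hc, ← TensorProduct.smul_tmul, ← TensorProduct.sum_tmul, b.sum_repr]
    | add x y hx hy =>
      simp only [map_add, TensorProduct.tmul_add, Finset.sum_add_distrib]
      rw [← hx, ← hy]
  have hcρ : ∀ i a z, c i (ρK a z) = ρ a (c i z) := by
    intro i a z
    induction z using TensorProduct.induction_on with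
    | zero => simp
    | tmul k y =>
      change c i (k ⊗ₜ[E] ρ a y) = _
      rw [hc, hc, map_smul]
    | add x y hx hy => simp only [map_add, hx, hy]
  let F : Fin (Module.finrank E K) → Module.End E N := fun i =>
    c i ∘ₗ ((f : Module.End K (K ⊗[E] N)).restrictScalars E) ∘ₗ (TensorProduct.mk E K N 1)
  have hF : ∀ i, F i ∈ Comm ρ := by
    intro i
    rw [mem_Comm]
    intro a x
    change c i ((f : Module.End K (K ⊗[E] N)) (1 ⊗ₜ ρ a x)) = ρ a (c i ((f : Module.End K (K ⊗[E] N)) (1 ⊗ₜ x)))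
    rw [← hcρ, ← mem_Comm.1 f.2]
    rfl
  refine ⟨∑ i, (⟨F i, hF i⟩ : Comm ρ) ⊗ₜ[E] b i, ?_⟩
  apply Subtype.ext
  apply LinearMap.ext
  intro z
  have h1 : ∀ (s : Comm ρ) (k : K) (z : K ⊗[E] N),
      ((Ψ (s ⊗ₜ k) : T) : Module.End K (K ⊗[E] N)) z = k • (s : Module.End E N).baseChange K z := by
    intro s k z
    have : Ψ (s ⊗ₜ k) = k • f1 s := by
      simp only [Ψ, Algebra.TensorProduct.lift_tmul]
      rw [Algebra.smul_def]
      exact (Algebra.commutes k (f1 s)).symm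
    rw [this]
    rfl
  change ((Ψ (∑ i, (⟨F i, hF i⟩ : Comm ρ) ⊗ₜ[E] b i) : T) : Module.End K (K ⊗[E] N)) z = _
  rw [map_sum, AddSubmonoidClass.coe_finsetSum, LinearMap.sum_apply]
  simp only [h1]
  induction z using TensorProduct.induction_on with
  | zero => simp
  | tmul k y =>
    have h2 : k ⊗ₜ[E] y = k • ((1 : K) ⊗ₜ[E] y) := by simp [TensorProduct.smul_tmul']
    rw [h2, map_smul, hz ((f : Module.End K (K ⊗[E] N)) (1 ⊗ₜ y)), Finset.smul_sum]
    refine Finset.sum_congr rfl fun i _ => ?_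
    rw [map_smul, smul_comm, LinearMap.baseChange_tmul, TensorProduct.smul_tmul', smul_eq_mul,
      mul_one]
    rfl
  | add x y hx hy => simp only [map_add, smul_add, Finset.sum_add_distrib, hx, hy]

end BC

lemma exists_min_retract {E A V : Type} [Field E] [AddCommGroup V] [Module E V]
    [FiniteDimensional E V] [Nontrivial V] (ρ : A → Module.End E V) :
    ∃ (N : Type) (_ : AddCommGroup N) (_ : Module E N) (_ : FiniteDimensional E N)
      (_ : Nontrivial N) (ρN : A → Module.End E N) (i : N →ₗ[E] V) (p : V →ₗ[E] N),
      (∀ x, p (i x) = x) ∧ (∀ a x, i (ρN a x) = ρ a (i x)) ∧ (∀ a x, p (ρ a x) = ρN a (p x)) ∧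
      (∀ x : Comm ρN, IsNilpotent x ∨ IsUnit x) := by
  classical
  let P : ℕ → Prop := fun d => ∃ (N : Type) (_ : AddCommGroup N) (_ : Module E N)
      (_ : FiniteDimensional E N)
      (_ : Nontrivial N) (ρN : A → Module.End E N) (i : N →ₗ[E] V) (p : V →ₗ[E] N),
      (∀ x, p (i x) = x) ∧ (∀ a x, i (ρN a x) = ρ a (i x)) ∧ (∀ a x, p (ρ a x) = ρN a (p x)) ∧
      Module.finrank E N = d
  have hP : ∃ d, P d := ⟨_, V, _, ‹_›, ‹_›, ‹_›, ρ, LinearMap.id, LinearMap.id, fun _ => rfl,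
    fun _ _ => rfl, fun _ _ => rfl, rfl⟩
  obtain ⟨N, _, _, _, _, ρN, i, p, hpi, hi, hp, hd⟩ := Nat.find_spec hP
  refine ⟨N, _, ‹_›, ‹_›, ‹_›, ρN, i, p, hpi, hi, hp, ?_⟩
  rintro ⟨x, hx⟩
  obtain ⟨m, hm, hm1⟩ := (x.eventually_isCompl_ker_pow_range_pow.and
    (Filter.eventually_ge_atTop 1)).exists
  have hxm : x ^ m ∈ Comm ρN := pow_mem hx m
  rw [mem_Comm] at hxm
  let W := LinearMap.ker (x ^ m)
  have hW : ∀ a, ∀ y ∈ W, ρN a y ∈ W := by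
    intro a y hy
    rw [LinearMap.mem_ker] at hy ⊢
    rw [hxm, hy, map_zero]
  have hW' : ∀ a, ∀ y ∈ LinearMap.range (x ^ m), ρN a y ∈ LinearMap.range (x ^ m) := by
    rintro a _ ⟨y, rfl⟩
    exact ⟨ρN a y, hxm a y⟩
  let q := W.projectionOnto _ hm
  have hq1 : ∀ w : W, q w = w := fun w => Submodule.projectionOnto_apply_left hm w
  have hq2 : ∀ w ∈ LinearMap.range (x ^ m), q w = 0 := fun w hw =>
    (Submodule.projectionOnto_apply_eq_zero_iff hm).2 hw
  have hqρ : ∀ a y, q (ρN a y) = (ρN a).restrict (hW a) (q y) := by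
    intro a y
    obtain ⟨w, hw, r, hr, rfl⟩ := Submodule.mem_sup.1
      (show y ∈ W ⊔ LinearMap.range (x ^ m) from hm.sup_eq_top ▸ Submodule.mem_top)
    have e1 := hq1 ⟨w, hw⟩
    have e2 := hq1 ⟨ρN a w, hW a w hw⟩
    rw [map_add, map_add, map_add, hq2 r hr, hq2 _ (hW' a r hr), add_zero, add_zero]
    simp only at e1 e2
    rw [e1, e2]
    rfl
  by_cases hWb : W = ⊥
  · right
    have hinj : Function.Injective x := by
      have h1 : Function.Injective (x ^ m) := LinearMap.ker_eq_bot.1 hWb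
      obtain ⟨m, rfl⟩ := Nat.exists_eq_add_of_le' hm1
      rw [pow_succ] at h1
      exact Function.Injective.of_comp h1
    have hbij : Function.Bijective x := ⟨hinj, LinearMap.injective_iff_surjective.1 hinj⟩
    obtain ⟨u, rfl⟩ := (Module.End.isUnit_iff x).2 hbij
    have hu : (↑u⁻¹ : Module.End E N) ∈ Comm ρN := by
      rw [Subalgebra.mem_centralizer_iff] at hx ⊢
      intro g hg
      exact (Commute.units_inv_right (hx g hg : Commute g u))
    rw [isUnit_iff_exists]
    exact ⟨⟨_, hu⟩, Subtype.ext u.mul_inv, Subtype.ext u.inv_mul⟩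
  · left
    have hnt : Nontrivial W := Submodule.nontrivial_iff_ne_bot.2 hWb
    have hmin := Nat.find_min' hP (m := Module.finrank E W)
      ⟨W, _, _, inferInstance, hnt, fun a => (ρN a).restrict (hW a), i ∘ₗ W.subtype, q ∘ₗ p, by
        intro y; simp [hpi, hq1], by
        intro a y; simp [hi], by
        intro a y; simp only [LinearMap.comp_apply, hp, hqρ], rfl⟩
    have hfin : Module.finrank E W = Module.finrank E N :=
      le_antisymm (Submodule.finrank_le W) (hd ▸ hmin)
    have htop := Submodule.eq_top_of_finrank_eq hfin
    refine ⟨m, Subtype.ext ?_⟩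
    exact LinearMap.ker_eq_top.1 htop

/-- The twisting property: for every Galois automorphism there is a semilinear injection. -/
def TwistInv (E K : Type) [Field E] [Field K] [Algebra E K] {A V : Type}
    [AddCommGroup V] [Module K V] [Module E V] (ρ : A → Module.End K V) : Prop :=
  ∀ h : K ≃ₐ[E] K, ∃ e : V →ₗ[E] V, Function.Injective e ∧ (∀ (k : K) x, e (k • x) = h k • e x) ∧
    ∀ a x, e (ρ a x) = ρ a (e x)

lemma exists_families {E K A V N : Type} [Field E] [Field K] [Algebra E K] [FiniteDimensional E K]
    [IsGalois E K] [AddCommGroup V] [Module K V] [Module E V] [IsScalarTower E K V]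
    [Module.Finite K V] [AddCommGroup N] [Module E N]
    (ρ : A → Module.End K V) (hρ : TwistInv E K ρ) (ρN : A → Module.End E N)
    (i : N →ₗ[E] V) (p : V →ₗ[E] N) (hpi : ∀ x, p (i x) = x)
    (hi : ∀ a x, i (ρN a x) = ρ a (i x)) (hp : ∀ a x, p (ρ a x) = ρN a (p x)) :
    ∃ (α : (K ≃ₐ[E] K) → (K ⊗[E] N →ₗ[K] V)) (β : (K ≃ₐ[E] K) → (V →ₗ[K] K ⊗[E] N)),
      (∀ h a x, α h ((ρN a).baseChange K x) = ρ a (α h x)) ∧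
      (∀ h a x, β h (ρ a x) = (ρN a).baseChange K (β h x)) ∧
      ∀ x, ∑ h, β h (α h x) = x := by
  classical
  have : FiniteDimensional E V := Module.Finite.trans K V
  choose e he hek hea using hρ
  let e' : (K ≃ₐ[E] K) → (V ≃ₗ[E] V) := fun h => LinearEquiv.ofInjectiveEndo (e h) (he h)
  have he' : ∀ h x, e' h x = e h x := fun h x => rfl
  have hes : ∀ h x, (e' h).symm (e h x) = x := fun h x => by
    rw [← he']; exact (e' h).symm_apply_apply x
  have hesk : ∀ h (k : K) x, (e' h).symm (k • e h x) = h.symm k • x := by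
    intro h k x
    rw [LinearEquiv.symm_apply_eq, he', hek, AlgEquiv.apply_symm_apply]
  have hesa : ∀ h a x, (e' h).symm (ρ a x) = ρ a ((e' h).symm x) := by
    intro h a x
    rw [LinearEquiv.symm_apply_eq, he', hea, ← he', LinearEquiv.apply_symm_apply]
  let b := Module.finBasis E K
  have hnd := traceForm_nondegenerate E K
  let d := (Algebra.traceForm E K).dualBasis hnd b
  have hd : ∀ x : K, x = ∑ j, Algebra.trace E K (x * b j) • d j := by
    intro x
    conv_lhs => rw [← d.sum_repr x]
    refine Finset.sum_congr rfl fun j _ => ?_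
    rw [LinearMap.BilinForm.dualBasis_repr_apply, Algebra.traceForm_apply]
  have hb : ∀ x : K, x = ∑ j, Algebra.trace E K (x * d j) • b j := by
    intro x
    conv_lhs => rw [← b.sum_repr x]
    refine Finset.sum_congr rfl fun j _ => ?_
    congr 1
    conv_rhs => rw [← b.sum_repr x]
    rw [Finset.sum_mul, map_sum, Finset.sum_eq_single j]
    · rw [smul_mul_assoc, map_smul, mul_comm, ← Algebra.traceForm_apply,
        LinearMap.BilinForm.apply_dualBasis_left]
      simp
    · intro l _ hl
      rw [smul_mul_assoc, map_smul, mul_comm, ← Algebra.traceForm_apply,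
        LinearMap.BilinForm.apply_dualBasis_left, if_neg hl, smul_zero]
    · simp
  let α : (K ≃ₐ[E] K) → (K ⊗[E] N →ₗ[K] V) := fun h => LinearMap.liftBaseChange K (e h ∘ₗ i)
  let g : (K ≃ₐ[E] K) → V →ₗ[E] N := fun h => p ∘ₗ (e' h).symm.toLinearMap
  have hgk : ∀ h (k : K) v, ∑ j, b j ⊗ₜ[E] g h (d j • k • v) = k • ∑ j, b j ⊗ₜ[E] g h (d j • v) := by
    intro h k v
    rw [Finset.smul_sum]
    have e1 : ∀ j, b j ⊗ₜ[E] g h (d j • k • v) =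
        ∑ l, Algebra.trace E K (d j * k * b l) • (b j ⊗ₜ[E] g h (d l • v)) := by
      intro j
      rw [smul_smul]
      conv_lhs => rw [hd (d j * k)]
      rw [Finset.sum_smul, map_sum, TensorProduct.tmul_sum]
      refine Finset.sum_congr rfl fun l _ => ?_
      rw [smul_assoc, map_smul, TensorProduct.tmul_smul]
    have e2 : ∀ l, k • (b l ⊗ₜ[E] g h (d l • v)) =
        ∑ j, Algebra.trace E K (d j * k * b l) • (b j ⊗ₜ[E] g h (d l • v)) := by
      intro l
      rw [TensorProduct.smul_tmul', smul_eq_mul]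
      conv_lhs => rw [hb (k * b l)]
      rw [TensorProduct.sum_tmul]
      refine Finset.sum_congr rfl fun j _ => ?_
      rw [TensorProduct.smul_tmul']
      congr 3
      ring
    simp only [e1, e2]
    exact Finset.sum_comm
  let β : (K ≃ₐ[E] K) → (V →ₗ[K] K ⊗[E] N) := fun h =>
    { toFun := fun v => ∑ j, b j ⊗ₜ[E] g h (d j • v)
      map_add' := by
        intro v w
        simp only [smul_add, map_add, TensorProduct.tmul_add, Finset.sum_add_distrib]
      map_smul' := hgk h }
  have hβ : ∀ h v, β h v = ∑ j, b j ⊗ₜ[E] g h (d j • v) := fun _ _ => rfl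
  refine ⟨α, β, ?_, ?_, ?_⟩
  · intro h a x
    induction x using TensorProduct.induction_on with
    | zero => simp
    | tmul k y => simp [α, hi, hea]
    | add x y hx hy => simp only [map_add, hx, hy]
  · intro h a x
    rw [hβ, hβ, map_sum]
    refine Finset.sum_congr rfl fun j _ => ?_
    rw [LinearMap.baseChange_tmul]
    congr 1
    simp only [g, LinearMap.comp_apply, LinearEquiv.coe_coe]
    rw [← map_smul, hesa, hp]
  · intro x
    induction x using TensorProduct.induction_on with
    | zero => simp
    | add x y hx hy => simp only [map_add, Finset.sum_add_distrib, hx, hy]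
    | tmul k y =>
      have e1 : ∀ h, β h (α h (k ⊗ₜ y)) = k • ∑ j, b j ⊗ₜ[E] p (h.symm (d j) • i y) := by
        intro h
        have e0 : α h (k ⊗ₜ y) = k • e h (i y) := by
          simp only [α, LinearMap.liftBaseChange_tmul, LinearMap.comp_apply]
        rw [e0, map_smul, hβ]
        congr 1
        simp only [g, LinearMap.comp_apply, LinearEquiv.coe_coe, hesk]
      simp only [e1]
      rw [← Finset.smul_sum, Finset.sum_comm]
      have e2 : ∀ j, ∑ h : K ≃ₐ[E] K, b j ⊗ₜ[E] p (h.symm (d j) • i y) =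
          (Algebra.trace E K (1 * d j) • b j) ⊗ₜ[E] y := by
        intro j
        rw [← TensorProduct.tmul_sum, ← map_sum, ← Finset.sum_smul]
        have : ∑ h : K ≃ₐ[E] K, h.symm (d j) = ∑ h : K ≃ₐ[E] K, h (d j) :=
          Fintype.sum_equiv (Equiv.inv _) _ _ (fun h => rfl)
        rw [this, ← trace_eq_sum_automorphisms, algebraMap_smul, map_smul, hpi, one_mul,
          TensorProduct.smul_tmul]
      simp only [e2]
      rw [← TensorProduct.sum_tmul, ← hb 1, TensorProduct.smul_tmul', smul_eq_mul, mul_one]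

lemma exists_split {K A V P ι : Type} [Field K] [AddCommGroup V] [Module K V]
    [AddCommGroup P] [Module K P] [Fintype ι]
    (ρ : A → Module.End K V) (ρP : A → Module.End K P) (hT : GoodRing (Comm ρP))
    (α : ι → (P →ₗ[K] V)) (β : ι → (V →ₗ[K] P))
    (hα : ∀ h a x, α h (ρP a x) = ρ a (α h x))
    (hβ : ∀ h a x, β h (ρ a x) = ρP a (β h x))
    (hs : ∀ x, ∑ h, β h (α h x) = x) :
    ∃ (α : P →ₗ[K] V) (β : V →ₗ[K] P), (∀ a x, α (ρP a x) = ρ a (α x)) ∧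
      (∀ a x, β (ρ a x) = ρP a (β x)) ∧ ∀ x, β (α x) = x := by
  classical
  let σ : ι → ι → Comm ρP := fun h l => ⟨β h ∘ₗ α l, by
    rw [mem_Comm]; intro a x; simp only [LinearMap.comp_apply, hα, hβ]⟩
  obtain ⟨s, u, hu⟩ := hT.1 ι σ (by
    apply Subtype.ext
    rw [AddSubmonoidClass.coe_finsetSum]
    apply LinearMap.ext
    intro x
    rw [LinearMap.sum_apply]
    exact hs x)
  have hsc : ∀ h a x, (s h).1 (ρP a x) = ρP a ((s h).1 x) := fun h => mem_Comm.1 (s h).2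
  have huc : ∀ a x, (u⁻¹).1.1 (ρP a x) = ρP a ((u⁻¹).1.1 x) := mem_Comm.1 (u⁻¹).1.2
  refine ⟨∑ l, α l ∘ₗ (s l).1, (u⁻¹).1.1 ∘ₗ ∑ h, (s h).1 ∘ₗ β h, ?_, ?_, ?_⟩
  · intro a x
    simp only [LinearMap.sum_apply, LinearMap.comp_apply, hsc, hα, map_sum]
  · intro a x
    simp only [LinearMap.sum_apply, LinearMap.comp_apply, hsc, hβ]
    rw [← map_sum, huc]
  · intro x
    have h1 : (u.1 : Comm ρP).1 x =
        (∑ h, (s h).1 ∘ₗ β h) ((∑ l, α l ∘ₗ (s l).1) x) := by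
      rw [hu, AddSubmonoidClass.coe_finsetSum, LinearMap.sum_apply, LinearMap.sum_apply]
      refine Finset.sum_congr rfl fun i _ => ?_
      rw [AddSubmonoidClass.coe_finsetSum, LinearMap.sum_apply, LinearMap.sum_apply, map_sum]
      rfl
    rw [LinearMap.comp_apply, ← h1]
    have h2 : (u⁻¹).1.1 * u.1.1 = 1 := congrArg Subtype.val u.inv_mul
    exact LinearMap.congr_fun h2 x

lemma cancel_aux {K A V P : Type} [Field K] [AddCommGroup V] [Module K V]
    [AddCommGroup P] [Module K P]
    (ρ : A → Module.End K V) (ρP : A → Module.End K P) (hT : GoodRing (Comm ρP))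
    (α g : P →ₗ[K] V) (β f : V →ₗ[K] P)
    (hα : ∀ a x, α (ρP a x) = ρ a (α x)) (hβ : ∀ a x, β (ρ a x) = ρP a (β x))
    (hβα : ∀ x, β (α x) = x)
    (hg : ∀ a x, g (ρP a x) = ρ a (g x)) (hf : ∀ a x, f (ρ a x) = ρP a (f x))
    (hfg : ∀ x, f (g x) = x) :
    ∃ γ : P →ₗ[K] V, (∀ a x, γ (ρP a x) = ρ a (γ x)) ∧ (∀ x, f (γ x) = x) ∧
      ∀ x, β (γ x) = 0 → x = 0 := by
  let a0 : Comm ρP := ⟨f ∘ₗ α, by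
    rw [mem_Comm]; intro a x; simp only [LinearMap.comp_apply, hα, hf]⟩
  let c0 : Comm ρP := ⟨β ∘ₗ g, by
    rw [mem_Comm]; intro a x; simp only [LinearMap.comp_apply, hg, hβ]⟩
  let δ : P →ₗ[K] V := g - α ∘ₗ β ∘ₗ g
  have hδ : ∀ a x, δ (ρP a x) = ρ a (δ x) := by
    intro a x
    simp only [δ, LinearMap.sub_apply, LinearMap.comp_apply, hα, hβ, hg, map_sub]
  have hβδ : ∀ x, β (δ x) = 0 := by
    intro x
    simp only [δ, LinearMap.sub_apply, LinearMap.comp_apply, map_sub, hβα, sub_self]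
  let b0 : Comm ρP := ⟨f ∘ₗ δ, by
    rw [mem_Comm]; intro a x; simp only [LinearMap.comp_apply, hδ, hf]⟩
  obtain ⟨t, u, hu⟩ := hT.2 a0 c0 b0 (by
    apply Subtype.ext
    apply LinearMap.ext
    intro x
    change f (α (β (g x))) + f (δ x) = x
    simp only [δ, LinearMap.sub_apply, LinearMap.comp_apply, map_sub, hfg]
    abel)
  have htc : ∀ a x, t.1 (ρP a x) = ρP a (t.1 x) := mem_Comm.1 t.2
  have huc : ∀ a x, (u⁻¹).1.1 (ρP a x) = ρP a ((u⁻¹).1.1 x) := mem_Comm.1 (u⁻¹).1.2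
  have h2 : ∀ x, u.1.1 ((u⁻¹).1.1 x) = x := LinearMap.congr_fun (congrArg Subtype.val u.mul_inv)
  have h3 : ∀ x, u.1.1 x = f (α x) + f (δ (t.1 x)) := by
    intro x; rw [hu]; rfl
  refine ⟨(α + δ ∘ₗ t.1) ∘ₗ (u⁻¹).1.1, ?_, ?_, ?_⟩
  · intro a x
    simp only [LinearMap.add_apply, LinearMap.comp_apply, huc, htc, hα, hδ, map_add]
  · intro x
    simp only [LinearMap.add_apply, LinearMap.comp_apply, map_add]
    rw [← h3, h2]
  · intro x hx
    simp only [LinearMap.add_apply, LinearMap.comp_apply, map_add, hβδ, hβα, add_zero] at hx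
    rw [← h2 x, hx, map_zero]

/-- The semilinear automorphism of the base change. -/
lemma exists_tensor_twist {E K A N : Type} [Field E] [Field K] [Algebra E K]
    [AddCommGroup N] [Module E N] (ρN : A → Module.End E N) (h : K ≃ₐ[E] K) :
    ∃ c : K ⊗[E] N ≃ₗ[E] K ⊗[E] N, (∀ (k : K) x, c (k • x) = h k • c x) ∧
      ∀ a x, c (bcOp K ρN a x) = bcOp K ρN a (c x) := by
  refine ⟨TensorProduct.congr h.toLinearEquiv (LinearEquiv.refl E N), ?_, ?_⟩
  · intro k x
    induction x using TensorProduct.induction_on with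
    | zero => simp
    | tmul l y => simp [TensorProduct.smul_tmul']
    | add x y hx hy => simp only [map_add, smul_add, hx, hy]
  · intro a x
    induction x using TensorProduct.induction_on with
    | zero => simp
    | tmul l y => simp
    | add x y hx hy => simp only [map_add, hx, hy]

lemma cancel_twist {E K A V N : Type} [Field E] [Field K] [Algebra E K] [FiniteDimensional E K]
    [AddCommGroup V] [Module K V] [Module E V] [IsScalarTower E K V]
    [Module.Finite K V] [AddCommGroup N] [Module E N]
    (ρ : A → Module.End K V) (hρ : TwistInv E K ρ) (ρN : A → Module.End E N)
    (hT : GoodRing (Comm (bcOp K ρN)))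
    (α : K ⊗[E] N →ₗ[K] V) (β : V →ₗ[K] K ⊗[E] N)
    (hα : ∀ a x, α (bcOp K ρN a x) = ρ a (α x))
    (hβ : ∀ a x, β (ρ a x) = bcOp K ρN a (β x)) (hβα : ∀ x, β (α x) = x)
    (hst : ∀ a, ∀ x ∈ LinearMap.ker β, ρ a x ∈ LinearMap.ker β) :
    TwistInv E K (V := LinearMap.ker β) (fun a => (ρ a).restrict (hst a)) := by
  intro h
  have : FiniteDimensional E V := Module.Finite.trans K V
  obtain ⟨e0, he, hek0, hea0⟩ := hρ h
  obtain ⟨e, hee⟩ : ∃ e : V ≃ₗ[E] V, ∀ x, e x = e0 x :=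
    ⟨LinearEquiv.ofInjectiveEndo e0 he, fun _ => rfl⟩
  have hek : ∀ (k : K) x, e (k • x) = h k • e x := by simpa only [hee] using hek0
  have hea : ∀ a x, e (ρ a x) = ρ a (e x) := by simpa only [hee] using hea0
  have hsk : ∀ (k : K) x, e.symm (h k • x) = k • e.symm x := by
    intro k x; rw [LinearEquiv.symm_apply_eq, hek, LinearEquiv.apply_symm_apply]
  have hsa : ∀ a x, e.symm (ρ a x) = ρ a (e.symm x) := by
    intro a x; rw [LinearEquiv.symm_apply_eq, hea, LinearEquiv.apply_symm_apply]
  obtain ⟨c, hck, hca⟩ := exists_tensor_twist (A := A) ρN h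
  have hcsk : ∀ (k : K) x, c.symm (h k • x) = k • c.symm x := by
    intro k x; rw [LinearEquiv.symm_apply_eq, hck, LinearEquiv.apply_symm_apply]
  have hcsa : ∀ a x, c.symm (bcOp K ρN a x) = bcOp K ρN a (c.symm x) := by
    intro a x; rw [LinearEquiv.symm_apply_eq, hca, LinearEquiv.apply_symm_apply]
  let f : V →ₗ[K] K ⊗[E] N :=
    { toFun := fun x => c.symm (β (e x))
      map_add' := by intro x y; simp only [map_add]
      map_smul' := by
        intro k x
        simp only [hek, map_smul, hcsk, RingHom.id_apply] }
  let g : K ⊗[E] N →ₗ[K] V :=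
    { toFun := fun x => e.symm (α (c x))
      map_add' := by intro x y; simp only [map_add]
      map_smul' := by
        intro k x
        simp only [hck, map_smul, hsk, RingHom.id_apply] }
  have hfv : ∀ x, f x = c.symm (β (e x)) := fun _ => rfl
  have hgv : ∀ x, g x = e.symm (α (c x)) := fun _ => rfl
  have hfa : ∀ a x, f (ρ a x) = bcOp K ρN a (f x) := by
    intro a x; rw [hfv, hea, hβ, hcsa, hfv]
  obtain ⟨γ, hγa, hfγ, hβγ⟩ := cancel_aux ρ (bcOp K ρN) hT α g β f hα hβ hβα
    (by intro a x; rw [hgv, hca, hα, hsa, hgv]) hfa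
    (by intro x; rw [hfv, hgv, LinearEquiv.apply_symm_apply, hβα, LinearEquiv.symm_apply_apply])
  have hker : ∀ y, β (e (y - γ (f y))) = 0 := by
    intro y
    have : f (y - γ (f y)) = 0 := by rw [map_sub, hfγ, sub_self]
    rw [hfv] at this
    exact c.symm.map_eq_zero_iff.1 this
  refine ⟨{ toFun := fun y => ⟨e (y.1 - γ (f y.1)), hker y.1⟩
            map_add' := ?_
            map_smul' := ?_ }, ?_, ?_, ?_⟩
  · intro x y
    apply Subtype.ext
    simp only [Submodule.coe_add, map_add, map_sub]
    abel
  · intro r x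
    apply Subtype.ext
    change e (r • x.1 - γ (f (r • x.1))) = r • e (x.1 - γ (f x.1))
    rw [← algebraMap_smul K r x.1, map_smul, map_smul, ← smul_sub, algebraMap_smul, map_smul]
  · intro x y hxy
    have h1 : e (x.1 - γ (f x.1)) = e (y.1 - γ (f y.1)) := congrArg Subtype.val hxy
    have h2 := e.injective h1
    have h3 : x.1 - y.1 = γ (f (x.1 - y.1)) := by
      rw [map_sub, map_sub]
      have := sub_eq_sub_iff_sub_eq_sub.1 h2
      exact this
    have h4 : β (x.1 - y.1) = 0 := (x - y).2
    have h5 : f (x.1 - y.1) = 0 := by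
      apply hβγ
      rw [← h3]; exact h4
    rw [h5, map_zero] at h3
    exact Subtype.ext (sub_eq_zero.1 h3)
  · intro k x
    apply Subtype.ext
    change e (k • x.1 - γ (f (k • x.1))) = h k • e (x.1 - γ (f x.1))
    rw [map_smul, map_smul, ← smul_sub, hek]
  · intro a x
    apply Subtype.ext
    change e (ρ a x.1 - γ (f (ρ a x.1))) = ρ a (e (x.1 - γ (f x.1)))
    rw [hfa, hγa, ← map_sub, hea]

theorem exists_descent_basis {E K A : Type} [Field E] [Field K] [Algebra E K]
    [FiniteDimensional E K] [IsGalois E K] (hE : DivComm E) :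
    ∀ (n : ℕ) (V : Type) [AddCommGroup V] [Module K V] [Module E V] [IsScalarTower E K V]
    [Module.Finite K V] (ρ : A → Module.End K V), Module.finrank K V = n → TwistInv E K ρ →
    ∃ (ι : Type) (_ : Fintype ι) (v : Module.Basis ι K V),
      ∀ a i j, v.repr (ρ a (v j)) i ∈ (algebraMap E K).range := by
  intro n
  induction n using Nat.strong_induction_on with
  | _ n ih =>
  intro V _ _ _ _ _ ρ hn hρ
  classical
  rcases subsingleton_or_nontrivial V with hV | hV
  · exact ⟨PEmpty, inferInstance, Module.Basis.empty V, fun a i => i.elim⟩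
  have : FiniteDimensional E V := Module.Finite.trans K V
  obtain ⟨N, _, _, _, _, ρN, i, p, hpi, hi, hp, hS⟩ :=
    exists_min_retract (E := E) (fun a => (ρ a).restrictScalars E)
  obtain ⟨α, β, hα, hβ, hs⟩ := exists_families ρ hρ ρN i p hpi hi hp
  have hT : GoodRing (Comm (bcOp K ρN)) :=
    good_Comm_baseChange ρN (good_tensor E K (Comm ρN) hE hS)
  obtain ⟨α, β, hα, hβ, hβα⟩ := exists_split ρ (bcOp K ρN) hT α β hα hβ hs
  have hst : ∀ a, ∀ x ∈ LinearMap.ker β, ρ a x ∈ LinearMap.ker β := by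
    intro a x hx
    rw [LinearMap.mem_ker] at hx ⊢
    rw [hβ, hx, map_zero]
  have htw := cancel_twist ρ hρ ρN hT α β hα hβ hβα hst
  have hlt : Module.finrank K (LinearMap.ker β) < n := by
    rw [← hn]
    apply Submodule.finrank_lt
    intro htop
    obtain ⟨y, hy⟩ := exists_ne (0 : N)
    have h0 : ∀ z, z = (0 : K ⊗[E] N) := by
      intro z
      rw [← hβα z, LinearMap.ker_eq_top.1 htop, LinearMap.zero_apply]
    have : Subsingleton (K ⊗[E] N) := ⟨fun a b => (h0 a).trans (h0 b).symm⟩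
    exact not_subsingleton (K ⊗[E] N) this
  obtain ⟨κ, _, w, hw⟩ := ih _ hlt (LinearMap.ker β) _ rfl htw
  let b := Module.finBasis E N
  let bP := Algebra.TensorProduct.basis K b
  let φ : V ≃ₗ[K] (K ⊗[E] N) × LinearMap.ker β :=
    { toFun := fun x => (β x, ⟨x - α (β x), by rw [LinearMap.mem_ker, map_sub, hβα, sub_self]⟩)
      invFun := fun z => α z.1 + z.2.1
      map_add' := by
        intro x y
        refine Prod.ext (map_add _ _ _) (Subtype.ext ?_)
        change x + y - α (β (x + y)) = (x - α (β x)) + (y - α (β y))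
        simp only [map_add]; abel
      map_smul' := by
        intro k x
        refine Prod.ext (map_smul _ _ _) (Subtype.ext ?_)
        change k • x - α (β (k • x)) = k • (x - α (β x))
        simp only [map_smul, smul_sub]
      left_inv := by intro x; simp
      right_inv := by
        rintro ⟨z, y, hy⟩
        rw [LinearMap.mem_ker] at hy
        refine Prod.ext ?_ (Subtype.ext ?_)
        · simp [hβα, hy]
        · simp [hβα, hy] }
  have hφ : ∀ x, φ x = (β x, ⟨x - α (β x), by
      rw [LinearMap.mem_ker, map_sub, hβα, sub_self]⟩) := fun _ => rfl
  have hφs : ∀ z, φ.symm z = α z.1 + z.2.1 := fun _ => rfl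
  have hφρ : ∀ a z, φ (ρ a (φ.symm z)) = (bcOp K ρN a z.1, (ρ a).restrict (hst a) z.2) := by
    intro a z
    rw [← LinearEquiv.eq_symm_apply, hφs, hφs, map_add, ← hα]
    rfl
  have hbP : ∀ a i j, bP.repr (bcOp K ρN a (bP j)) i ∈ (algebraMap E K).range := by
    intro a i j
    have : bcOp K ρN a (bP j) = 1 ⊗ₜ ρN a (b j) := by simp [bP]
    rw [this]
    refine ⟨b.repr (ρN a (b j)) i, ?_⟩
    simp [bP, Algebra.algebraMap_eq_smul_one]
  refine ⟨_ ⊕ κ, inferInstance, (bP.prod w).map φ.symm, ?_⟩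
  intro a i j
  rw [Module.Basis.map_repr, Module.Basis.map_apply, LinearEquiv.trans_apply,
    LinearEquiv.symm_symm, hφρ]
  rcases i with i | i <;> rcases j with j | j
  · simpa using hbP a i j
  · simp
  · simp
  · simpa using hw a i j

lemma divComm_of_c1 {F E : Type} [Field F] [Field E] [Algebra F E] [FiniteDimensional F E]
    (hC1 : IsC1Field F) : DivComm E := by
  intro D _ _ _ _ hD x y
  let : Algebra F D := Algebra.compHom D (algebraMap F E)
  have : IsScalarTower F E D := IsScalarTower.of_algebraMap_eq fun _ => rfl
  have : Module.Finite F D := Module.Finite.trans E D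
  exact comm_of_c1 hC1 hD x y

section Final
variable {F K A : Type} [Field F] [Field K] [Algebra F K]
    [FiniteDimensional F K] [IsGalois F K]
    [Ring A] [Algebra F A]
    {M : Type} [AddCommGroup M] [Module F M] [Module K M] [Module A M]
    [IsScalarTower F K M] [IsScalarTower F A M] [SMulCommClass K A M]

lemma stab_one : StabilizesModule F K A M 1 :=
  ⟨AddEquiv.refl M, fun _ _ => rfl, fun _ _ => rfl⟩

lemma stab_mul {g h : K ≃ₐ[F] K} (hg : StabilizesModule F K A M g)
    (hh : StabilizesModule F K A M h) : StabilizesModule F K A M (g * h) := by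
  obtain ⟨e, he, he'⟩ := hg
  obtain ⟨f, hf, hf'⟩ := hh
  refine ⟨f.trans e, fun k x => ?_, fun a x => ?_⟩
  · simp only [AddEquiv.trans_apply, hf, he, AlgEquiv.mul_apply]
  · simp only [AddEquiv.trans_apply, hf', he']

lemma stab_inv {g : K ≃ₐ[F] K} (hg : StabilizesModule F K A M g) :
    StabilizesModule F K A M g⁻¹ := by
  obtain ⟨e, he, he'⟩ := hg
  refine ⟨e.symm, fun k x => ?_, fun a x => ?_⟩
  · rw [AddEquiv.symm_apply_eq, he, AddEquiv.apply_symm_apply]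
    congr 1
    exact (g.apply_symm_apply k).symm
  · rw [AddEquiv.symm_apply_eq, he', AddEquiv.apply_symm_apply]

lemma stab_of_descends (L : IntermediateField F K) (hL : DescendsTo F K A M L)
    (g : K ≃ₐ[F] K) (hg : ∀ x ∈ L, g x = x) : StabilizesModule F K A M g := by
  obtain ⟨N, hN, hb⟩ := hL
  let g' : K ≃ₐ[L] K := AlgEquiv.ofRingEquiv (f := g.toRingEquiv) (fun x => hg x x.2)
  let ρN : A → Module.End L N := fun a =>
    { toFun := fun x => ⟨a • x.1, hN a x.1 x.2⟩
      map_add' := fun x y => Subtype.ext (smul_add a x.1 y.1)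
      map_smul' := fun c x => Subtype.ext ((smul_comm (c : K) a x.1).symm) }
  obtain ⟨c, hc, hca⟩ := exists_tensor_twist (A := A) ρN g'
  have hea : ∀ a x, hb.equiv (bcOp K ρN a x) = a • hb.equiv x := by
    intro a x
    induction x using TensorProduct.induction_on with
    | zero => simp
    | tmul k y =>
      rw [LinearMap.baseChange_tmul, IsBaseChange.equiv_tmul, IsBaseChange.equiv_tmul, ← smul_comm k a]
      rfl
    | add x y hx hy => simp only [map_add, smul_add, hx, hy]
  have hes : ∀ a x, hb.equiv.symm (a • x) = bcOp K ρN a (hb.equiv.symm x) := by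
    intro a x
    rw [LinearEquiv.symm_apply_eq, hea, LinearEquiv.apply_symm_apply]
  refine ⟨(hb.equiv.symm.toAddEquiv.trans c.toAddEquiv).trans hb.equiv.toAddEquiv, ?_, ?_⟩
  · intro k x
    change hb.equiv (c (hb.equiv.symm (k • x))) = g k • hb.equiv (c (hb.equiv.symm x))
    rw [map_smul, hc, map_smul]
    rfl
  · intro a x
    change hb.equiv (c (hb.equiv.symm (a • x))) = a • hb.equiv (c (hb.equiv.symm x))
    rw [hes, hca, hea]

lemma descends_of_basis (K₀ : IntermediateField F K) {ι : Type} [Fintype ι]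
    (v : Module.Basis ι K M)
    (hv : ∀ (a : A) i j, v.repr (a • v j) i ∈ (algebraMap K₀ K).range) :
    DescendsTo F K A M K₀ := by
  refine ⟨Submodule.span K₀ (Set.range v), ?_, ?_⟩
  · intro a x hx
    induction hx using Submodule.span_induction with
    | mem x hx =>
      obtain ⟨j, rfl⟩ := hx
      rw [Module.Basis.mem_span_iff_repr_mem]
      intro i
      exact hv a i j
    | zero => rw [smul_zero]; exact Submodule.zero_mem _
    | add x y _ _ hx hy => rw [smul_add]; exact Submodule.add_mem _ hx hy
    | smul c x _ hx =>
      have : a • c • x = c • a • x := (smul_comm (c : K) a x).symm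
      rw [this]
      exact Submodule.smul_mem _ _ hx
  · let b := v.restrictScalars K₀
    let e := (Algebra.TensorProduct.basis K b).equiv v (Equiv.refl ι)
    refine IsBaseChange.of_equiv e ?_
    have : (e.toLinearMap.restrictScalars K₀) ∘ₗ
        (TensorProduct.mk K₀ K (Submodule.span K₀ (Set.range v)) 1) =
        (Submodule.span K₀ (Set.range v)).subtype := by
      refine b.ext fun i => ?_
      have h1 : e ((Algebra.TensorProduct.basis K b) i) = v i := by
        exact (Module.Basis.equiv_apply _ _ _ _)
      rw [Algebra.TensorProduct.basis_apply] at h1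
      have h2 : ((b i : Submodule.span K₀ (Set.range v)) : M) = v i :=
        Module.Basis.restrictScalars_apply K₀ v i
      exact h1.trans h2.symm
    exact fun x => LinearMap.congr_fun this x

end Final

/-- Let `F` be a `C₁`-field, `A` a finite-dimensional `F`-algebra,
`K/F` a finite Galois extension with group `G = Gal(K/F)`, and `M` a finitely
generated `A_K`-module.  Then the fixed field `K^{G_M}` of the stabilizer
`G_M = {g ∈ G : ᵍM ≅ M}` is the minimal field of definition of `M`. -/
theorem fixedField_of_stabilizer_is_minimal_field_of_definition
    (F K A : Type) [Field F] [Field K] [Algebra F K]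
    [FiniteDimensional F K] [IsGalois F K]
    [Ring A] [Algebra F A] [FiniteDimensional F A]
    (hC1 : IsC1Field F)
    (M : Type) [AddCommGroup M] [Module F M] [Module K M] [Module A M]
    [IsScalarTower F K M] [IsScalarTower F A M] [SMulCommClass K A M]
    [Module.Finite K M]
    (K₀ : IntermediateField F K)
    (hK₀ : ∀ x : K, x ∈ K₀ ↔ ∀ g : K ≃ₐ[F] K, StabilizesModule F K A M g → g x = x) :
    DescendsTo F K A M K₀ ∧
      ∀ L : IntermediateField F K, DescendsTo F K A M L → K₀ ≤ L := by
  classical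
  constructor
  · have : FiniteDimensional F K₀ := inferInstance
    have hE : DivComm K₀ := divComm_of_c1 hC1
    let H : Subgroup (K ≃ₐ[F] K) :=
      { carrier := {g | StabilizesModule F K A M g}
        mul_mem' := fun hg hh => stab_mul hg hh
        one_mem' := stab_one
        inv_mem' := fun hg => stab_inv hg }
    have hKH : K₀ = IntermediateField.fixedField H := by
      ext x
      rw [hK₀, IntermediateField.mem_fixedField_iff]
      rfl
    let ρ : A → Module.End K M := fun a =>
      { toFun := fun x => a • x
        map_add' := smul_add a
        map_smul' := fun k x => (smul_comm k a x).symm }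
    have htw : TwistInv K₀ K ρ := by
      intro h
      have hh : h.restrictScalars F ∈ H := by
        rw [← IntermediateField.fixingSubgroup_fixedField H, ← hKH,
          IntermediateField.mem_fixingSubgroup_iff]
        intro x hx
        exact h.commutes ⟨x, hx⟩
      obtain ⟨e, he, hea⟩ := hh
      have he' : ∀ (k : K) x, e (k • x) = h k • e x := he
      refine ⟨{ toFun := e, map_add' := map_add e, map_smul' := ?_ }, e.injective, he', hea⟩
      intro c x
      have := he' (algebraMap K₀ K c) x
      rw [h.commutes] at this
      exact this
    obtain ⟨ι, _, v, hv⟩ := exists_descent_basis hE _ M ρ rfl htw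
    exact descends_of_basis K₀ v hv
  · intro L hL x hx
    rw [← IsGalois.fixedField_fixingSubgroup L, IntermediateField.mem_fixedField_iff]
    intro g hg
    rw [IntermediateField.mem_fixingSubgroup_iff] at hg
    exact (hK₀ x).1 hx g (stab_of_descends L hL g hg)
end

section
/- Let F be a C₁-field, A a finite-dimensional F-algebra of finite representation type, and K/F a field extension in which F is perfectly closed. Then every indecomposable finitely generated A_K-module M descends to an intermediate field F ⊆ E ⊆ K with [E : F] < ∞. -/
open TensorProduct

/-- A module is indecomposable if it is nontrivial and admits no nontrivial
direct sum decomposition. -/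
def IsIndecomposableModule (A M : Type) [Ring A] [AddCommGroup M] [Module A M] : Prop :=
  Nontrivial M ∧ ∀ N P : Submodule A M, IsCompl N P → N = ⊥ ∨ P = ⊥

/-- The ring `A` has finite representation type: there are only finitely many
isomorphism classes of finitely generated indecomposable `A`-modules. -/
def FiniteRepType (A : Type) [Ring A] : Prop :=
  ∃ S : Set (ModuleCat.{0} A), S.Finite ∧
    ∀ M : ModuleCat.{0} A, Module.Finite A M → IsIndecomposableModule A M →
      ∃ N ∈ S, Nonempty (M ≃ₗ[A] N)

/-- `F` is perfectly closed in `K`: every finite subextension of `K/F` is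
separable over `F`. -/
def PerfectlyClosedIn (F K : Type) [Field F] [Field K] [Algebra F K] : Prop :=
  ∀ E : IntermediateField F K, FiniteDimensional F E → Algebra.IsSeparable F E

/-- The `A_K`-module `M` (a `K`-module with commuting `A`-action) is indecomposable:
it is nontrivial and has no nontrivial decomposition into `A_K`-submodules. -/
def IsIndecomposableAK (K A M : Type) [Field K] [Ring A]
    [AddCommGroup M] [Module K M] [Module A M] : Prop :=
  Nontrivial M ∧ ∀ N P : Submodule K M,
    (∀ (a : A) (x : M), x ∈ N → a • x ∈ N) → (∀ (a : A) (x : M), x ∈ P → a • x ∈ P) →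
    IsCompl N P → N = ⊥ ∨ P = ⊥


section C1part
open MvPolynomial

lemma homComp_mul {σ F : Type} [Field F] (f g : MvPolynomial σ F) :
    homogeneousComponent (f.totalDegree + g.totalDegree) (f * g) =
      homogeneousComponent f.totalDegree f * homogeneousComponent g.totalDegree g := by
  have hfg : f * g = ∑ i ∈ Finset.range (f.totalDegree + 1), ∑ j ∈ Finset.range (g.totalDegree + 1),
      homogeneousComponent i f * homogeneousComponent j g := by
    rw [← Finset.sum_mul_sum, sum_homogeneousComponent f, sum_homogeneousComponent g]
  rw [hfg]
  simp only [_root_.map_sum]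
  have key : ∀ i j, homogeneousComponent (f.totalDegree + g.totalDegree)
      (homogeneousComponent i f * homogeneousComponent j g) =
      if f.totalDegree + g.totalDegree = i + j then
        homogeneousComponent i f * homogeneousComponent j g else 0 := fun i j =>
    homogeneousComponent_of_mem
      ((homogeneousComponent_isHomogeneous i f).mul (homogeneousComponent_isHomogeneous j g))
  simp_rw [key]
  rw [Finset.sum_eq_single f.totalDegree, Finset.sum_eq_single g.totalDegree]
  · simp
  · intro j _ hj
    rw [if_neg]; omega
  · simp
  · intro i hi hne
    apply Finset.sum_eq_zero
    intro j hj
    rw [if_neg]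
    simp only [Finset.mem_range] at hi hj
    omega
  · simp

/-- A form of degree `n` in `n` variables over a `C₁` field without nontrivial zeros is
irreducible. -/
lemma irreducible_of_no_zero {F : Type} [Field F] (hC1 : IsC1Field F) {n : ℕ} (hn : 0 < n)
    (P : MvPolynomial (Fin n) F) (hP : P.IsHomogeneous n)
    (h0 : ∀ x : Fin n → F, x ≠ 0 → eval x P ≠ 0) : Irreducible P := by
  have hPne : P ≠ 0 := by
    rintro rfl
    exact h0 (fun _ => 1) (fun h => by simpa using congrFun h ⟨0, hn⟩) (by simp)
  have hcoef : constantCoeff P = 0 := by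
    rw [constantCoeff_eq]; apply hP.coeff_eq_zero; simpa using hn.ne
  constructor
  · intro hu
    have := hu.map (constantCoeff (σ := Fin n) (R := F))
    rw [hcoef] at this
    simp at this
  · intro f g hfg
    by_contra! hcon
    obtain ⟨hf, hg⟩ := hcon
    have hf0 : f ≠ 0 := by rintro rfl; simp [hPne] at hfg
    have hg0 : g ≠ 0 := by rintro rfl; simp [hPne] at hfg
    have hdeg : f.totalDegree + g.totalDegree = n := by
      rw [← totalDegree_mul_of_isDomain hf0 hg0, ← hfg, hP.totalDegree hPne]
    have pos : ∀ q : MvPolynomial (Fin n) F, q ≠ 0 → ¬ IsUnit q → 0 < q.totalDegree := by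
      intro q hq0 hq
      rw [Nat.pos_iff_ne_zero]
      intro h
      rw [totalDegree_eq_zero_iff_eq_C] at h
      apply hq
      rw [h]
      apply IsUnit.map
      rw [isUnit_iff_ne_zero]
      rintro h'
      rw [h', C_0] at h
      exact hq0 h
    have h1 := pos f hf0 hf
    have h2 := pos g hg0 hg
    have hmul := homComp_mul f g
    rw [hdeg, ← hfg, homogeneousComponent_of_mem hP, if_pos rfl] at hmul
    obtain ⟨x, hx, hx0⟩ := hC1 n f.totalDegree _
      (homogeneousComponent_isHomogeneous f.totalDegree f) h1 (by omega)
    apply h0 x hx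
    rw [hmul, map_mul, hx0, zero_mul]

lemma exists_basis_one {F D : Type} [Field F] [DivisionRing D] [Algebra F D]
    [Module.Finite F D] : ∃ (n : ℕ) (b : Module.Basis (Fin (n+1)) F D), b 0 = 1 := by
  obtain ⟨N, hN⟩ := Submodule.exists_isCompl (Submodule.span F {(1 : D)})
  let b := Module.finBasis F N
  refine ⟨_, Module.Basis.mkFinCons (1 : D) b ?_ ?_, by rw [Module.Basis.coe_mkFinCons]; rfl⟩
  · intro c x hx h
    have hx' : x ∈ Submodule.span F {(1 : D)} := by
      rw [Submodule.mem_span_singleton]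
      exact ⟨-c, by rw [neg_smul]; exact (eq_neg_of_add_eq_zero_right h).symm⟩
    have : x = 0 := Submodule.disjoint_def.1 hN.disjoint x hx' hx
    subst this
    simpa using h
  · intro z
    have hz : z ∈ Submodule.span F {(1 : D)} ⊔ N := by rw [hN.sup_eq_top]; trivial
    obtain ⟨y, hy, w, hw, rfl⟩ := Submodule.mem_sup.1 hz
    obtain ⟨c, rfl⟩ := Submodule.mem_span_singleton.1 hy
    refine ⟨-c, ?_⟩
    have : c • (1 : D) + w + -c • (1 : D) = w := by rw [neg_smul]; abel
    rwa [this]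

lemma comm_of_cyclic {Q S T : Type} [Field Q] [Ring S] [Ring T] [Algebra Q S] [Algebra Q T]
    [Module.Finite Q S] [Module.Finite Q T] (Ψ : S →ₐ[Q] T) (Y : T) (hYmem : Y ∈ Ψ.range)
    (hdeg : Module.finrank Q S ≤ (minpoly Q Y).natDegree) (s t : S) :
    Ψ s * Ψ t = Ψ t * Ψ s := by
  have hle : Algebra.adjoin Q {Y} ≤ Ψ.range := Algebra.adjoin_le (Set.singleton_subset_iff.2 hYmem)
  have hfr1 : (minpoly Q Y).natDegree ≤ Module.finrank Q (Algebra.adjoin Q {Y}) := by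
    have hli := linearIndependent_pow (K := Q) Y
    let w : Fin (minpoly Q Y).natDegree → Algebra.adjoin Q {Y} := fun i =>
      ⟨Y ^ (i : ℕ), pow_mem (Algebra.self_mem_adjoin_singleton Q Y) _⟩
    have hw : LinearIndependent Q w :=
      LinearIndependent.of_comp (Algebra.adjoin Q {Y}).val.toLinearMap hli
    simpa using hw.fintype_card_le_finrank
  have hfr2 : Module.finrank Q Ψ.range ≤ (minpoly Q Y).natDegree :=
    (LinearMap.finrank_range_le Ψ.toLinearMap).trans hdeg
  have heq : Algebra.adjoin Q {Y} = Ψ.range :=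
    Subalgebra.eq_of_le_of_finrank_le hle (hfr2.trans hfr1)
  have hmem : ∀ d, ∃ p : Polynomial Q, Polynomial.aeval Y p = Ψ d := fun d => by
    have : Ψ d ∈ Algebra.adjoin Q {Y} := by rw [heq]; exact ⟨d, rfl⟩
    rw [Algebra.adjoin_singleton_eq_range_aeval] at this
    exact this
  obtain ⟨p, hp⟩ := hmem s
  obtain ⟨q, hq⟩ := hmem t
  rw [← hp, ← hq, ← _root_.map_mul, ← _root_.map_mul, mul_comm]

set_option maxHeartbeats 400000 in
/-- A finite-dimensional division algebra over a `C₁` field is commutative. -/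
lemma C1_div_comm {F D : Type} [Field F] [DivisionRing D] [Algebra F D]
    [Module.Finite F D] (hC1 : IsC1Field F) (x y : D) : x * y = y * x := by
  obtain ⟨n, b, hb⟩ := exists_basis_one (F := F) (D := D)
  let Lm := Algebra.leftMulMatrix b
  have hL0 : Lm (b 0) = 1 := by rw [hb, map_one]
  let R' := MvPolynomial (Fin n) F
  let X' : Matrix (Fin (n+1)) (Fin (n+1)) R' :=
    Matrix.of fun i j => -∑ k : Fin n, (X k : R') * C (Lm (b k.succ) i j)
  let G : Matrix (Fin (n+1)) (Fin (n+1)) (MvPolynomial (Fin (n+1)) F) :=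
    Matrix.of fun i j => ∑ k : Fin (n+1), X k * C (Lm (b k) i j)
  have hGX : finSuccEquiv F n G.det = X'.charpoly := by
    rw [Matrix.charpoly, AlgEquiv.map_det]
    congr 1
    ext1 i j
    simp only [AlgEquiv.mapMatrix_apply, Matrix.map_apply, G, X', Matrix.charmatrix_apply,
      Matrix.of_apply, Fin.sum_univ_succ, hL0, _root_.map_add, _root_.map_mul, _root_.map_sum]
    have hX0 := MvPolynomial.finSuccEquiv_X_zero (R := F) (n := n)
    have hXs : ∀ j : Fin n, _ := fun j => MvPolynomial.finSuccEquiv_X_succ (R := F) (n := n) (j := j)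
    have hC : ∀ r : F, finSuccEquiv F n (C r) = Polynomial.C (C r) := fun r => by
      simp [finSuccEquiv_apply]
    simp only [hC, Matrix.one_apply, Matrix.diagonal_apply]
    rw [hX0]
    have hsum : ∑ x : Fin n, MvPolynomial.finSuccEquiv F n (X x.succ) *
          Polynomial.C (C (Lm (b x.succ) i j)) =
        Polynomial.C (∑ x : Fin n, X x * C (Lm (b x.succ) i j)) := by
      rw [_root_.map_sum]
      refine Finset.sum_congr rfl fun x _ => ?_
      rw [hXs x, Polynomial.C_mul]
    rw [hsum]
    split_ifs <;> simp
  have hGhom : G.det.IsHomogeneous (n+1) := by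
    rw [Matrix.det_apply']
    apply IsHomogeneous.sum
    intro σ _
    have hgoal := IsHomogeneous.mul (m := 0) (n := n+1) (φ := ((Equiv.Perm.sign σ : ℤ) :
      MvPolynomial (Fin (n+1)) F)) (ψ := ∏ i, G (σ i) i) ?_ ?_
    · rwa [zero_add] at hgoal
    · have : ((Equiv.Perm.sign σ : ℤ) : MvPolynomial (Fin (n+1)) F) =
        C ((Equiv.Perm.sign σ : ℤ) : F) := by simp
      rw [this]
      apply isHomogeneous_C
    · have := IsHomogeneous.prod Finset.univ (fun i => G (σ i) i) (fun _ => 1) ?_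
      · simpa using this
      · intro i _
        simp only [G, Matrix.of_apply]
        apply IsHomogeneous.sum
        intro j _
        exact (isHomogeneous_X _ j).mul (isHomogeneous_C _ _)
  have hGev : ∀ v : Fin (n+1) → F, v ≠ 0 → eval v G.det ≠ 0 := by
    intro v hv
    have h1 : (eval v) G.det = (Lm (∑ i, v i • b i)).det := by
      rw [RingHom.map_det]
      congr 1
      ext i j
      simp [G, Matrix.sum_apply]
    rw [h1, ← isUnit_iff_ne_zero, ← Matrix.isUnit_iff_isUnit_det]
    apply IsUnit.map
    rw [isUnit_iff_ne_zero]
    intro h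
    apply hv
    funext i
    exact Fintype.linearIndependent_iff.1 b.linearIndependent v h i
  have hirr := irreducible_of_no_zero hC1 (Nat.succ_pos n) _ hGhom hGev
  have hirr2 : Irreducible X'.charpoly := by
    rw [← hGX]; exact (MulEquiv.irreducible_iff (finSuccEquiv F n)).2 hirr
  let Q := FractionRing R'
  have hmon := Matrix.charpoly_monic X'
  have hirr3 := (hmon.irreducible_iff_irreducible_map_fraction_map (K := Q)).1 hirr2
  let Y := X'.map (algebraMap R' Q)
  have hYc : Y.charpoly = X'.charpoly.map (algebraMap R' Q) := Matrix.charpoly_map X' _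
  rw [← hYc] at hirr3
  have hIntegral : IsIntegral Q Y := Algebra.IsIntegral.isIntegral Y
  have hassoc : Associated Y.charpoly (minpoly Q Y) :=
    ((hirr3.dvd_iff).1 (Matrix.minpoly_dvd_charpoly Y)).resolve_left (minpoly.not_isUnit Q Y)
  have hdeg : (minpoly Q Y).natDegree = n + 1 := by
    rw [← Polynomial.natDegree_eq_of_degree_eq (Polynomial.degree_eq_degree_of_associated hassoc),
      Matrix.charpoly_natDegree_eq_dim, Fintype.card_fin]
  let ψ : D →ₐ[F] Matrix (Fin (n+1)) (Fin (n+1)) Q :=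
    (Algebra.ofId F Q).mapMatrix.comp Lm
  let Ψ : Q ⊗[F] D →ₐ[Q] Matrix (Fin (n+1)) (Fin (n+1)) Q :=
    Algebra.TensorProduct.lift (Algebra.ofId Q _) ψ (fun _ _ => Algebra.commutes _ _)
  have hΨ : ∀ q d, Ψ (q ⊗ₜ d) = algebraMap Q _ q * ψ d := fun _ _ =>
    Algebra.TensorProduct.lift_tmul ..
  have hYmem : Y ∈ Ψ.range := by
    refine ⟨-∑ k : Fin n, (algebraMap R' Q (X k)) ⊗ₜ b k.succ, ?_⟩
    have e1 : Ψ (-∑ k : Fin n, (algebraMap R' Q (X k)) ⊗ₜ b k.succ) =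
        -∑ k : Fin n, (algebraMap R' Q (X k)) • ψ (b k.succ) := by
      rw [_root_.map_neg, _root_.map_sum]
      congr 1
      refine Finset.sum_congr rfl fun k _ => ?_
      rw [hΨ, Algebra.smul_def]
    refine Eq.trans e1 ?_
    ext i j
    have e2 : Y i j = algebraMap R' Q (-∑ k : Fin n, (X k : R') * C (Lm (b k.succ) i j)) := rfl
    rw [e2, _root_.map_neg, _root_.map_sum, Matrix.neg_apply, Matrix.sum_apply]
    congr 1
    refine Finset.sum_congr rfl fun k _ => ?_
    rw [_root_.map_mul, Matrix.smul_apply, smul_eq_mul]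
    congr 1
  have h1 : Module.finrank Q (Q ⊗[F] D) = n + 1 := by
    rw [Module.finrank_baseChange, Module.finrank_eq_card_basis b, Fintype.card_fin]
  have hcomm := comm_of_cyclic Ψ Y hYmem (h1.trans hdeg.symm).le (1 ⊗ₜ x) (1 ⊗ₜ y)
  rw [hΨ, hΨ, map_one, one_mul, one_mul] at hcomm
  have hinj : Function.Injective ψ := RingHom.injective ψ.toRingHom
  apply hinj
  rw [map_mul, map_mul, hcomm]

end C1part


section MacLane

lemma pow_p_indep {K : Type} [Field K] {p : ℕ} (hp : p.Prime) [ExpChar K p] {t : K}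
    (ht : ∀ b : K, b ^ p ≠ t) (y : Fin p → K) (h : ∑ j : Fin p, t ^ (j : ℕ) * y j ^ p = 0) : y = 0 := by
  have hirr := X_pow_sub_C_irreducible_of_prime hp ht
  obtain ⟨s, hs⟩ := IsAlgClosed.exists_pow_nat_eq (algebraMap K (AlgebraicClosure K) t) hp.pos
  have : ExpChar (AlgebraicClosure K) p :=
    expChar_of_injective_algebraMap (algebraMap K (AlgebraicClosure K)).injective p
  have h1 : ∑ j : Fin p, s ^ (j : ℕ) * algebraMap K (AlgebraicClosure K) (y j) = 0 := by
    apply eq_zero_of_pow_eq_zero (n := p)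
    rw [sum_pow_char p]
    have := congrArg (algebraMap K (AlgebraicClosure K)) h
    rw [map_sum, map_zero] at this
    rw [← this]
    refine Finset.sum_congr rfl fun j _ => ?_
    rw [mul_pow, map_mul, map_pow, map_pow, ← hs, ← pow_mul, ← pow_mul, mul_comm (j : ℕ)]
  let P : Polynomial K := ∑ j : Fin p, Polynomial.monomial (j : ℕ) (y j)
  have hP : Polynomial.aeval s P = 0 := by
    rw [← h1, map_sum]
    refine Finset.sum_congr rfl fun j _ => ?_
    rw [Polynomial.aeval_monomial, mul_comm]
  have hmin : Polynomial.X ^ p - Polynomial.C t = minpoly K s := by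
    apply minpoly.eq_of_irreducible_of_monic hirr
    · simp [hs]
    · exact Polynomial.monic_X_pow_sub_C t hp.ne_zero
  have hP0 : P = 0 := by
    apply Polynomial.eq_zero_of_dvd_of_degree_lt (minpoly.dvd K s hP)
    rw [← hmin, Polynomial.degree_X_pow_sub_C hp.pos]
    refine (Polynomial.degree_sum_le _ _).trans_lt ?_
    rw [Finset.sup_lt_iff (WithBot.bot_lt_coe _)]
    intro j _
    exact (Polynomial.degree_monomial_le _ _).trans_lt (by exact_mod_cast j.2)
  funext j
  have := congrArg (fun q => Polynomial.coeff q (j : ℕ)) hP0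
  simpa [P, Polynomial.finsetSum_coeff, Polynomial.coeff_monomial, Fin.val_inj] using this

lemma C1_pbasis {F : Type} [Field F] (hC1 : IsC1Field F) {p : ℕ} (hp : p.Prime) [ExpChar F p]
    {t : F} (ht : ∀ b : F, b ^ p ≠ t) (a : F) : ∃ c : Fin p → F, a = ∑ j : Fin p, t ^ (j : ℕ) * c j ^ p := by
  let v : Fin (p+1) → F := Fin.snoc (fun j : Fin p => t ^ (j : ℕ)) a
  obtain ⟨x, hx, hx0⟩ := hC1 (p+1) p (∑ i, MvPolynomial.C (v i) * MvPolynomial.X i ^ p)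
    (by
      apply MvPolynomial.IsHomogeneous.sum
      intro i _
      have := (MvPolynomial.isHomogeneous_C (Fin (p+1)) (v i)).mul
        ((MvPolynomial.isHomogeneous_X F i).pow p)
      simpa using this) hp.pos (Nat.lt_succ_self p)
  simp only [map_sum, map_mul, map_pow, MvPolynomial.eval_C, MvPolynomial.eval_X] at hx0
  rw [Fin.sum_univ_castSucc] at hx0
  simp only [v, Fin.snoc_castSucc, Fin.snoc_last] at hx0
  by_cases hl : x (Fin.last p) = 0
  · exfalso
    rw [hl, zero_pow hp.ne_zero, mul_zero, add_zero] at hx0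
    have := pow_p_indep hp ht _ hx0
    apply hx
    funext i
    refine Fin.lastCases hl (fun i => ?_) i
    exact congrFun this i
  · refine ⟨fun j => - x j.castSucc / x (Fin.last p), ?_⟩
    have hl' : x (Fin.last p) ^ p ≠ 0 := pow_ne_zero _ hl
    have hneg : ((-1 : F)) ^ p = -1 := by
      have h := add_pow_expChar (1 : F) (-1) p
      rw [add_neg_cancel, zero_pow hp.ne_zero, one_pow] at h
      linear_combination -h
    have h2 : ∀ j : Fin p, t ^ (j : ℕ) * (- x j.castSucc / x (Fin.last p)) ^ p =
        - (t ^ (j : ℕ) * x j.castSucc ^ p) / x (Fin.last p) ^ p := by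
      intro j
      rw [div_pow, neg_pow, hneg]; ring
    simp_rw [h2]
    rw [← Finset.sum_div, Finset.sum_neg_distrib, eq_div_iff hl']
    linear_combination hx0

lemma not_pow_of_perfectlyClosed {F K : Type} [Field F] [Field K] [Algebra F K]
    (hpc : PerfectlyClosedIn F K) {p : ℕ} (hp : p.Prime) [CharP F p] {t : F}
    (ht : ∀ b : F, b ^ p ≠ t) (s : K) : s ^ p ≠ algebraMap F K t := by
  intro hs
  have hirr := X_pow_sub_C_irreducible_of_prime hp ht
  have hmin : Polynomial.X ^ p - Polynomial.C t = minpoly F s := by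
    apply minpoly.eq_of_irreducible_of_monic hirr
    · simp [hs]
    · exact Polynomial.monic_X_pow_sub_C t hp.ne_zero
  have hIntegral : IsIntegral F s := ⟨_, Polynomial.monic_X_pow_sub_C t hp.ne_zero, by simp [hs]⟩
  have hfin : FiniteDimensional F (IntermediateField.adjoin F {s}) :=
    IntermediateField.adjoin.finiteDimensional hIntegral
  have hsep := hpc _ hfin
  have h1 : IsSeparable F (⟨s, IntermediateField.mem_adjoin_simple_self F s⟩ :
    IntermediateField.adjoin F {s}) := Algebra.IsSeparable.isSeparable F _
  have h2 : (minpoly F s).Separable := by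
    have := h1
    rw [IsSeparable, ← minpoly.algebraMap_eq (algebraMap (IntermediateField.adjoin F {s}) K).injective] at this
    exact this
  rw [← hmin, Polynomial.Separable] at h2
  simp only [Polynomial.derivative_sub, Polynomial.derivative_X_pow, Polynomial.derivative_C,
    CharP.cast_eq_zero, Polynomial.C_0, zero_mul, sub_zero, isCoprime_zero_right] at h2
  exact hirr.not_isUnit h2

lemma pow_linearIndependent {F K : Type} [Field F] [Field K] [Algebra F K] (hC1 : IsC1Field F)
    (hpc : PerfectlyClosedIn F K) {p : ℕ} (hp : p.Prime) [CharP F p] {ι : Type} [Fintype ι]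
    (k : ι → K) (hk : LinearIndependent F k) : LinearIndependent F (fun i => k i ^ p) := by
  have : Fact p.Prime := ⟨hp⟩
  have : ExpChar F p := ExpChar.prime hp
  have : ExpChar K p := expChar_of_injective_algebraMap (algebraMap F K).injective p
  rw [Fintype.linearIndependent_iff] at hk ⊢
  intro a ha
  by_cases hperf : ∀ t : F, ∃ b, b ^ p = t
  · choose c hc using hperf
    have : (∑ i, c (a i) • k i) ^ p = 0 := by
      rw [sum_pow_char p, ← ha]
      refine Finset.sum_congr rfl fun i _ => ?_
      rw [smul_pow, hc]
    have := hk _ (eq_zero_of_pow_eq_zero this)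
    intro i
    rw [← hc (a i), this i, zero_pow hp.ne_zero]
  · push Not at hperf
    obtain ⟨t, ht⟩ := hperf
    choose c hc using C1_pbasis hC1 hp ht
    have h0 : ∑ j : Fin p, (algebraMap F K t) ^ (j : ℕ) * (∑ i, c (a i) j • k i) ^ p = 0 := by
      rw [← ha]
      simp_rw [sum_pow_char p, Finset.mul_sum]
      rw [Finset.sum_comm]
      refine Finset.sum_congr rfl fun i _ => ?_
      conv_rhs => rw [hc (a i)]
      rw [Finset.sum_smul]
      refine Finset.sum_congr rfl fun j _ => ?_
      rw [smul_pow, ← map_pow, ← Algebra.smul_def, smul_smul]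
    have h1 := pow_p_indep hp (not_pow_of_perfectlyClosed hpc hp ht) _ h0
    intro i
    rw [hc (a i)]
    refine Finset.sum_eq_zero fun j _ => ?_
    rw [hk _ (congrFun h1 j) i, zero_pow hp.ne_zero, mul_zero]

lemma tmul_indep {F V W ι : Type} [Field F] [AddCommGroup V] [Module F V] [AddCommGroup W]
    [Module F W] [Fintype ι] {v : ι → V} (hv : LinearIndependent F v) {w : ι → W}
    (h : ∑ i, v i ⊗ₜ[F] w i = 0) (i : ι) : w i = 0 := by
  classical
  obtain ⟨g, hg⟩ := LinearMap.exists_leftInverse_of_injective _ (LinearMap.ker_eq_bot.2 hv)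
  have hgi : ∀ j, g (v j) = Finsupp.single j 1 := fun j => by
    have := LinearMap.congr_fun hg (Finsupp.single j 1)
    simpa using this
  have h2 := congrArg ((TensorProduct.lid F W).toLinearMap ∘ₗ
    LinearMap.rTensor W (Finsupp.lapply i ∘ₗ g)) h
  simpa [hgi, Finsupp.single_apply, ite_smul, map_sum] using h2

lemma exists_tmul_indep {F V W : Type} [Field F] [AddCommGroup V] [Module F V] [AddCommGroup W]
    [Module F W] (z : V ⊗[F] W) : ∃ (n : ℕ) (v : Fin n → V) (w : Fin n → W),
      LinearIndependent F v ∧ z = ∑ i, v i ⊗ₜ w i := by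
  obtain ⟨f, hf⟩ := TensorProduct.eq_repr_basis_left (Module.Basis.ofVectorSpace F V) z
  let e := f.support.equivFin.symm
  refine ⟨f.support.card, fun i => Module.Basis.ofVectorSpace F V (e i), fun i => f (e i), ?_, ?_⟩
  · exact (Module.Basis.ofVectorSpace F V).linearIndependent.comp _
      (Subtype.val_injective.comp e.injective)
  · rw [← hf, Finsupp.sum, ← Finset.sum_coe_sort]
    exact (Equiv.sum_comp e _).symm

lemma tensor_reduced {F K L : Type} [Field F] [Field K] [Field L] [Algebra F K] [Algebra F L]
    [Module.Finite F L] (hC1 : IsC1Field F) (hpc : PerfectlyClosedIn F K) :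
    IsReduced (K ⊗[F] L) := by
  obtain ⟨p, hp⟩ := CharP.exists F
  rcases CharP.char_is_prime_or_zero F p with hpp | rfl
  · have : ExpChar F p := ExpChar.prime hpp
    have : ExpChar (K ⊗[F] L) p := expChar_of_injective_algebraMap (algebraMap F _).injective p
    rw [isReduced_iff_pow_one_lt p hpp.one_lt]
    intro z hz
    obtain ⟨n, k, l, hk, rfl⟩ := exists_tmul_indep z
    rw [sum_pow_char p] at hz
    simp only [Algebra.TensorProduct.tmul_pow] at hz
    have := tmul_indep (pow_linearIndependent hC1 hpc hpp k hk) hz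
    refine Finset.sum_eq_zero fun i _ => ?_
    rw [eq_zero_of_pow_eq_zero (this i), tmul_zero]
  · have := CharP.charP_to_charZero F
    have : Algebra.FormallyEtale F L := Algebra.FormallyEtale.of_isSeparable F L
    exact Algebra.FormallyUnramified.isReduced_of_field K (K ⊗[F] L)

end MacLane


section Idem

/-- The canonical map `E ⊗ B → K ⊗ B`. -/
noncomputable def inclE {F K : Type} [Field F] [Field K] [Algebra F K] (E : IntermediateField F K)
    (B : Type) [Ring B] [Algebra F B] : E ⊗[F] B →ₐ[F] K ⊗[F] B :=
  Algebra.TensorProduct.map E.val (AlgHom.id F B)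

lemma inclE_tmul {F K : Type} [Field F] [Field K] [Algebra F K] (E : IntermediateField F K)
    (B : Type) [Ring B] [Algebra F B] (e : E) (b : B) :
    inclE E B (e ⊗ₜ b) = (e : K) ⊗ₜ b := Algebra.TensorProduct.map_tmul ..

lemma inclE_injective {F K : Type} [Field F] [Field K] [Algebra F K] (E : IntermediateField F K)
    (B : Type) [Ring B] [Algebra F B] : Function.Injective (inclE E B) :=
  Module.Flat.rTensor_preserves_injective_linearMap (M := B) E.val.toLinearMap
    Subtype.val_injective

lemma inclE_mono {F K : Type} [Field F] [Field K] [Algebra F K] {E E' : IntermediateField F K}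
    (h : E ≤ E') (B : Type) [Ring B] [Algebra F B] {x : K ⊗[F] B} (hx : x ∈ (inclE E B).range) :
    x ∈ (inclE E' B).range := by
  obtain ⟨y, rfl⟩ := hx
  refine ⟨Algebra.TensorProduct.map (IntermediateField.inclusion h) (AlgHom.id F B) y, ?_⟩
  induction y with
  | zero => simp
  | add x y hx hy => simp only [map_add] at *; rw [hx, hy]
  | tmul e b => rfl

lemma exists_finite_E {F K : Type} [Field F] [Field K] [Algebra F K]
    (B : Type) [Ring B] [Algebra F B] (x : (integralClosure F K) ⊗[F] B) :
    ∃ E : IntermediateField F K, FiniteDimensional F E ∧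
      Algebra.TensorProduct.map (integralClosure F K).val (AlgHom.id F B) x ∈ (inclE E B).range := by
  induction x with
  | zero => exact ⟨⊥, inferInstance, by rw [map_zero]; exact zero_mem _⟩
  | add x y hx hy =>
    obtain ⟨E, hE, hx⟩ := hx
    obtain ⟨E', hE', hy⟩ := hy
    exact ⟨E ⊔ E', inferInstance, by
      rw [map_add]; exact add_mem (inclE_mono le_sup_left B hx) (inclE_mono le_sup_right B hy)⟩
  | tmul k b =>
    have hIntegral : IsIntegral F (k : K) := k.2
    refine ⟨IntermediateField.adjoin F {(k : K)}, IntermediateField.adjoin.finiteDimensional hIntegral,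
      ⟨⟨k, IntermediateField.mem_adjoin_simple_self F _⟩ ⊗ₜ b, ?_⟩⟩
    rfl

lemma idem_descends {F K L : Type} [Field F] [Field K] [Field L] [Algebra F K] [Algebra F L]
    [Module.Finite F L] (c : K ⊗[F] L) (hc : c * c = c) :
    ∃ E : IntermediateField F K, FiniteDimensional F E ∧ ∃ e : E ⊗[F] L, e * e = e ∧
      inclE E L e = c := by
  obtain ⟨q, hq⟩ := ExpChar.exists F
  have : ExpChar (K ⊗[F] L) q := expChar_of_injective_algebraMap (algebraMap F _).injective q
  have : ExpChar L q := expChar_of_injective_algebraMap (algebraMap F _).injective q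
  let Ls := separableClosure F L
  have : ExpChar Ls q := expChar_of_injective_algebraMap (algebraMap F _).injective q
  let j : K ⊗[F] Ls →ₐ[F] K ⊗[F] L := Algebra.TensorProduct.map (AlgHom.id F K) Ls.val
  have hj : Function.Injective j :=
    Module.Flat.lTensor_preserves_injective_linearMap (M := K) Ls.val.toLinearMap
      Subtype.val_injective
  -- a Frobenius power lands in the separable part
  have hpow : ∀ z : K ⊗[F] L, ∃ n : ℕ, ∀ m, n ≤ m → z ^ q ^ m ∈ j.range := by
    intro z
    induction z with
    | zero =>
      refine ⟨0, fun m _ => ?_⟩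
      rw [zero_pow (pow_pos (expChar_pos F q) m).ne']; exact zero_mem _
    | add x y hx hy =>
      obtain ⟨n, hn⟩ := hx
      obtain ⟨n', hn'⟩ := hy
      refine ⟨max n n', fun m hm => ?_⟩
      rw [add_pow_expChar_pow]
      exact add_mem (hn m ((le_max_left _ _).trans hm)) (hn' m ((le_max_right _ _).trans hm))
    | tmul k l =>
      obtain ⟨n, y, hy⟩ := IsPurelyInseparable.pow_mem Ls q l
      refine ⟨n, fun m hm => ⟨(k ^ q ^ m) ⊗ₜ (y ^ q ^ (m - n)), ?_⟩⟩
      rw [Algebra.TensorProduct.tmul_pow]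
      have h2 : ((y : L)) = l ^ q ^ n := hy
      have h3 : l ^ q ^ m = ((y ^ q ^ (m - n) : Ls) : L) := by
        rw [SubmonoidClass.coe_pow, h2, ← pow_mul, ← pow_add, Nat.add_sub_cancel' hm]
      rw [h3]
      rfl
  obtain ⟨n, hn⟩ := hpow c
  have hidem : IsIdempotentElem c := hc
  have hcn := hn n le_rfl
  rw [hidem.pow_eq (pow_pos (expChar_pos F q) n).ne'] at hcn
  obtain ⟨cs, hcs⟩ := hcn
  have hcs2 : cs * cs = cs := hj (by rw [map_mul]; exact (congrArg₂ _ hcs hcs).trans (hc.trans hcs.symm))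
  -- flip
  let fl : K ⊗[F] Ls ≃ₐ[F] Ls ⊗[F] K := Algebra.TensorProduct.comm F K Ls
  have : Algebra.FormallyEtale F Ls := Algebra.FormallyEtale.of_isSeparable F Ls
  have : Algebra.Smooth F Ls := ⟨inferInstance,
    Algebra.FinitePresentation.of_finiteType.1 inferInstance⟩
  have hIntegral : IsIntegral Ls (fl cs) := by
    refine ⟨Polynomial.X ^ 2 - Polynomial.X, ?_, ?_⟩
    · monicity!
    · have : fl cs * fl cs = fl cs := by rw [← map_mul, hcs2]
      simp [sq, this]
  obtain ⟨x, hx⟩ := (TensorProduct.toIntegralClosure_bijective_of_smooth (R := F) (S := Ls)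
    (B := K)).2 ⟨fl cs, hIntegral⟩
  have hx' : Algebra.TensorProduct.map (AlgHom.id Ls Ls) (integralClosure F K).val x = fl cs :=
    congrArg Subtype.val hx
  obtain ⟨E, hE, y, hy⟩ := exists_finite_E L
    (Algebra.TensorProduct.map (AlgHom.id F _) Ls.val (Algebra.TensorProduct.comm F _ _ x))
  have key : ∀ x : Ls ⊗[F] integralClosure F K,
      Algebra.TensorProduct.map (integralClosure F K).val (AlgHom.id F L)
        (Algebra.TensorProduct.map (AlgHom.id F _) Ls.val (Algebra.TensorProduct.comm F _ _ x)) =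
      j (fl.symm (Algebra.TensorProduct.map (AlgHom.id Ls Ls) (integralClosure F K).val x)) := by
    intro x
    induction x with
    | zero => simp
    | add x y hx hy => simp only [map_add] at *; rw [hx, hy]
    | tmul l k => rfl
  have hyc : inclE E L y = c := by
    refine hy.trans ?_
    rw [key, hx', AlgEquiv.symm_apply_apply]
    exact hcs
  refine ⟨E, hE, y, inclE_injective E L ?_, hyc⟩
  rw [map_mul, hyc, hc]

lemma field_level {F K L : Type} [Field F] [Field K] [Field L] [Algebra F K] [Algebra F L]
    [Module.Finite F L] (hC1 : IsC1Field F) (hpc : PerfectlyClosedIn F K)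
    (z : K ⊗[F] L) (hz : z ≠ 0) :
    ∃ w : K ⊗[F] L, w * z ≠ 0 ∧
    ∃ E : IntermediateField F K, FiniteDimensional F E ∧ ∃ e : E ⊗[F] L, e * e = e ∧
      inclE E L e = w * z := by
  have hred := tensor_reduced (L := L) hC1 hpc
  have hart : IsArtinianRing (K ⊗[F] L) := IsArtinianRing.of_finite K _
  obtain ⟨n, y, hy⟩ := IsArtinian.exists_pow_succ_smul_dvd z (1 : K ⊗[F] L)
  simp only [smul_eq_mul, mul_one] at hy
  have h1 : z - z * z * y = 0 := by
    apply eq_zero_of_pow_eq_zero (n := n + 1)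
    have : z - z * z * y = z * (1 - z * y) := by ring
    rw [this, mul_pow, pow_succ (1 - z * y)]
    have h2 : z ^ (n+1) * (1 - z * y) = 0 := by
      have : z ^ (n+1) * (1 - z * y) = z * (z ^ n - z ^ (n+1) * y) := by ring
      rw [this]
      have hy' : z ^ (n+1) * y = z ^ n := hy
      rw [hy', sub_self, mul_zero]
    linear_combination ((1 - z * y) ^ n) * h2
  have hne : y * z ≠ 0 := by
    intro h
    apply hz
    linear_combination h1 + z * h
  obtain ⟨E, hE, e, he, hee⟩ := idem_descends (y * z) (by linear_combination -y * h1)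
  exact ⟨y, hne, E, hE, e, he, hee⟩

lemma div_level {F K D : Type} [Field F] [Field K] [iD : DivisionRing D] [Algebra F K] [Algebra F D]
    [Module.Finite F D] (hC1 : IsC1Field F) (hpc : PerfectlyClosedIn F K)
    (z : K ⊗[F] D) (hz : z ≠ 0) :
    ∃ w : K ⊗[F] D, w * z ≠ 0 ∧
    ∃ E : IntermediateField F K, FiniteDimensional F E ∧ ∃ e : E ⊗[F] D, e * e = e ∧
      inclE E D e = w * z := by
  have hcomm := C1_div_comm (D := D) hC1
  obtain ⟨fD, hfD⟩ : ∃ f : Field D, f.toDivisionRing = iD :=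
    ⟨{ iD with mul_comm := hcomm }, rfl⟩
  subst hfD
  exact field_level hC1 hpc z hz

end Idem


section LemmaW

/-- The `R`-span of `1 ⊗ I` in `R ⊗ B`. -/
def TI {F : Type} [Field F] (R : Type) [Field R] [Algebra F R] {B : Type} [Ring B] [Algebra F B]
    (I : Ideal B) : Submodule R (R ⊗[F] B) :=
  Submodule.span R ((fun b => (1 : R) ⊗ₜ[F] b) '' (I : Set B))

variable {F R B : Type} [Field F] [Field R] [Algebra F R] [Ring B] [Algebra F B]

lemma tmul_mem_TI {I : Ideal B} (r : R) {b : B} (hb : b ∈ I) : r ⊗ₜ[F] b ∈ TI (F := F) R I := by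
  have : r ⊗ₜ[F] b = r • ((1 : R) ⊗ₜ[F] b) := by rw [smul_tmul', smul_eq_mul, mul_one]
  rw [this]
  exact Submodule.smul_mem _ _ (Submodule.subset_span ⟨b, hb, rfl⟩)

lemma TI_mul {I J : Ideal B} {x y : R ⊗[F] B} (hx : x ∈ TI R I) (hy : y ∈ TI R J) :
    x * y ∈ TI R (I * J) := by
  have h := Submodule.mul_mem_mul hx hy
  rw [TI, TI, Submodule.span_mul_span] at h
  refine Submodule.span_mono ?_ h
  rintro _ ⟨_, ⟨a, ha, rfl⟩, _, ⟨b, hb, rfl⟩, rfl⟩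
  exact ⟨a * b, Ideal.mul_mem_mul ha hb, by simp⟩

lemma TI_mono {I J : Ideal B} (h : I ≤ J) : TI (F := F) R I ≤ TI R J :=
  Submodule.span_mono (Set.image_mono h)

lemma TI_top (x : R ⊗[F] B) : x ∈ TI R (⊤ : Ideal B) := by
  induction x with
  | zero => exact zero_mem _
  | add x y hx hy => exact add_mem hx hy
  | tmul r b => exact tmul_mem_TI r trivial

lemma TI_bot {x : R ⊗[F] B} (hx : x ∈ TI R (⊥ : Ideal B)) : x = 0 := by
  rw [TI, Submodule.bot_coe, Set.image_singleton, tmul_zero, Submodule.span_zero_singleton] at hx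
  exact hx

lemma TI_mul_left {I : Ideal B} (y : R ⊗[F] B) {x : R ⊗[F] B} (hx : x ∈ TI R I) :
    y * x ∈ TI R I :=
  TI_mono (Ideal.mul_le.2 fun _ _ _ h => Ideal.mul_mem_left _ _ h) (TI_mul (TI_top y) hx)

lemma TI_mul_right {I : Ideal B} [I.IsTwoSided] (y : R ⊗[F] B) {x : R ⊗[F] B} (hx : x ∈ TI R I) :
    x * y ∈ TI R I :=
  TI_mono (Ideal.mul_le.2 fun _ h _ _ => Ideal.mul_mem_right _ _ h) (TI_mul hx (TI_top y))

lemma TI_pow {I : Ideal B} {x : R ⊗[F] B} (hx : x ∈ TI R I) (n : ℕ) : x ^ n ∈ TI R (I ^ n) := by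
  induction n with
  | zero => rw [pow_zero, Submodule.pow_zero, Ideal.one_eq_top]; exact TI_top 1
  | succ n ih => rw [pow_succ, Submodule.pow_succ]; exact TI_mul ih hx

lemma TI_nilp {I : Ideal B} (hI : IsNilpotent I) {x : R ⊗[F] B} (hx : x ∈ TI R I) :
    IsNilpotent x := by
  obtain ⟨n, hn⟩ := hI
  refine ⟨n, TI_bot ?_⟩
  have := TI_pow hx n
  rwa [hn] at this

lemma ker_TI {C : Type} [Ring C] [Algebra F C] (π : B →ₐ[F] C) (hπ : Function.Surjective π)
    {I : Ideal B} (hI : ∀ b, π b = 0 → b ∈ I) {x : R ⊗[F] B}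
    (hx : Algebra.TensorProduct.map (AlgHom.id F R) π x = 0) : x ∈ TI R I := by
  have hex := lTensor_exact R (LinearMap.exact_subtype_ker_map π.toLinearMap) hπ
  obtain ⟨y, rfl⟩ := (hex x).1 hx
  induction y with
  | zero => rw [map_zero]; exact zero_mem _
  | add x y hx' hy' =>
    have h0 : ∀ y, Algebra.TensorProduct.map (AlgHom.id F R) π
      ((LinearMap.lTensor R (LinearMap.ker π.toLinearMap).subtype) y) = 0 := fun y => (hex _).2 ⟨y, rfl⟩
    rw [map_add]
    exact add_mem (hx' (h0 x)) (hy' (h0 y))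
  | tmul r b => exact tmul_mem_TI r (hI _ b.2)

section inc
variable {n : ℕ} {D : Fin n → Type} {d : Fin n → ℕ} [∀ i, DivisionRing (D i)]
  [∀ i, Algebra F (D i)]

/-- inclusion of a matrix entry -/
def incM (F : Type) [Field F] [∀ i, Algebra F (D i)] (i : Fin n) (s t : Fin (d i)) : D i →ₗ[F] ((i : Fin n) → Matrix (Fin (d i)) (Fin (d i)) (D i)) :=
  LinearMap.single F _ i ∘ₗ Matrix.singleLinearMap F s t

/-- a matrix entry -/
def entM (F : Type) [Field F] [∀ i, Algebra F (D i)] (i : Fin n) (s t : Fin (d i)) : ((i : Fin n) → Matrix (Fin (d i)) (Fin (d i)) (D i)) →ₗ[F] D i :=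
  Matrix.entryLinearMap F (D i) s t ∘ₗ LinearMap.proj i

lemma incM_mul_mul (i : Fin n) (s t : Fin (d i)) (w : D i)
    (c : (i : Fin n) → Matrix (Fin (d i)) (Fin (d i)) (D i)) :
    incM F i s s w * c * incM F i t s 1 = incM F i s s (w * entM F i s t c) := by
  funext i'
  by_cases h : i' = i
  · subst h
    simp [incM, entM]
  · simp [incM, entM, h]

lemma incM_mul (i : Fin n) (s : Fin (d i)) (w w' : D i) :
    incM F i s s w * incM F i s s w' = incM F i s s (w * w') := by
  funext i'
  by_cases h : i' = i
  · subst h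
    simp [incM]
  · simp [incM, h]

lemma entM_incM (i : Fin n) (s t : Fin (d i)) (w : D i) : entM F i s t (incM F i s t w) = w := by
  simp [incM, entM]

lemma sum_incM (c : (i : Fin n) → Matrix (Fin (d i)) (Fin (d i)) (D i)) :
    ∑ i, ∑ s, ∑ t, incM F i s t (entM F i s t c) = c := by
  have : ∀ i, ∑ s, ∑ t, incM F i s t (entM F i s t c) = Pi.single i (c i) := fun i => by
    simp only [incM, entM, LinearMap.comp_apply, ← map_sum]
    conv_rhs => rw [Matrix.matrix_eq_sum_single (c i)]
    rfl
  simp_rw [this]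
  exact Finset.univ_sum_single c

end inc

set_option maxHeartbeats 1000000 in
lemma lemmaW {K : Type} [Field K] [Algebra F K] [Module.Finite F B] (hC1 : IsC1Field F)
    (hpc : PerfectlyClosedIn F K) (q : K ⊗[F] B) (hq : q ∉ TI K (Ring.jacobson B)) :
    ∃ E : IntermediateField F K, FiniteDimensional F E ∧ ∃ e : E ⊗[F] B, e * e = e ∧
      inclE E B e ≠ 0 ∧ ∃ a b : K ⊗[F] B, inclE E B e = a * q * b := by
  have : IsArtinianRing B := IsArtinianRing.of_finite F B
  have hss : IsSemisimpleRing (B ⧸ Ring.jacobson B) := IsSemiprimaryRing.isSemisimpleRing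
  have hnil : IsNilpotent (Ring.jacobson B) := IsSemiprimaryRing.isNilpotent
  obtain ⟨n, D, d, iD, iA, iF, hd, ⟨φ⟩⟩ :=
    IsSemisimpleRing.exists_algEquiv_pi_matrix_divisionRing_finite F (B ⧸ Ring.jacobson B)
  let C := (i : Fin n) → Matrix (Fin (d i)) (Fin (d i)) (D i)
  let π : B →ₐ[F] C := φ.toAlgHom.comp (Ideal.Quotient.mkₐ F (Ring.jacobson B))
  have hπ : Function.Surjective π := φ.surjective.comp Ideal.Quotient.mk_surjective
  have hker : ∀ b, π b = 0 → b ∈ Ring.jacobson B := fun b hb => by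
    have : Ideal.Quotient.mk (Ring.jacobson B) b = 0 := φ.injective (hb.trans (map_zero φ).symm)
    exact Ideal.Quotient.eq_zero_iff_mem.1 this
  let πK : K ⊗[F] B →ₐ[F] K ⊗[F] C := Algebra.TensorProduct.map (AlgHom.id F K) π
  have hπK : Function.Surjective πK := LinearMap.lTensor_surjective K (g := π.toLinearMap) hπ
  have hqb : πK q ≠ 0 := fun h => hq (ker_TI π hπ hker h)
  obtain ⟨i, s, t, hz⟩ : ∃ i s t, LinearMap.lTensor K (entM F i s t) (πK q) ≠ 0 := by
    by_contra! hcon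
    apply hqb
    have hid : ∀ x : K ⊗[F] C, x = ∑ i, ∑ s, ∑ t, LinearMap.lTensor K (incM F i s t)
        (LinearMap.lTensor K (entM F i s t) x) := by
      intro x
      induction x with
      | zero => simp
      | add x y hx hy =>
        simp only [map_add, Finset.sum_add_distrib]
        rw [← hx, ← hy]
      | tmul k c =>
        simp only [LinearMap.lTensor_tmul, ← tmul_sum]
        rw [sum_incM]
    rw [hid (πK q)]
    simp [hcon]
  obtain ⟨w, hw, E, hE, e, he, hee⟩ := div_level hC1 hpc _ hz
  have key1 : ∀ (w : K ⊗[F] D i) (x : K ⊗[F] C), LinearMap.lTensor K (incM F i s s) w * x *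
      LinearMap.lTensor K (incM F i t s) (1 ⊗ₜ 1) = LinearMap.lTensor K (incM F i s s)
        (w * LinearMap.lTensor K (entM F i s t) x) := by
    intro w x
    induction w with
    | zero => simp
    | add w w' h h' => simp only [map_add, add_mul, h, h']
    | tmul k d =>
      induction x with
      | zero => simp
      | add x x' h h' => simp only [map_add, add_mul, mul_add, h, h']
      | tmul k' c =>
        simp only [LinearMap.lTensor_tmul, Algebra.TensorProduct.tmul_mul_tmul, mul_one,
          incM_mul_mul]
  have key2 : ∀ (w w' : E ⊗[F] D i), LinearMap.lTensor E (incM F i s s) w *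
      LinearMap.lTensor E (incM F i s s) w' = LinearMap.lTensor E (incM F i s s) (w * w') := by
    intro w x
    induction w with
    | zero => simp
    | add w w' h h' => simp only [map_add, add_mul, h, h']
    | tmul k d =>
      induction x with
      | zero => simp
      | add x x' h h' => simp only [map_add, mul_add, h, h']
      | tmul k' c =>
        simp only [LinearMap.lTensor_tmul, Algebra.TensorProduct.tmul_mul_tmul, incM_mul]
  let πE : E ⊗[F] B →ₐ[F] E ⊗[F] C := Algebra.TensorProduct.map (AlgHom.id F E) π
  have hπE : Function.Surjective πE := LinearMap.lTensor_surjective E (g := π.toLinearMap) hπ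
  obtain ⟨f, hf, hfe⟩ := exists_isIdempotentElem_eq_of_ker_isNilpotent πE.toRingHom
    (fun x hx => TI_nilp hnil (ker_TI π hπ hker (RingHom.mem_ker.1 hx))) (LinearMap.lTensor E (incM F i s s) e)
    (by obtain ⟨y, hy⟩ := hπE (LinearMap.lTensor E (incM F i s s) e); exact ⟨y, hy⟩)
    (by rw [IsIdempotentElem, key2, he])
  have key3 : ∀ x : E ⊗[F] B, πK (inclE E B x) = inclE E C (πE x) := by
    intro x
    induction x with
    | zero => simp
    | add x y hx hy => simp only [map_add, hx, hy]
    | tmul k b => rfl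
  have key4 : ∀ x : E ⊗[F] D i, inclE E C (LinearMap.lTensor E (incM F i s s) x) =
      LinearMap.lTensor K (incM F i s s) (inclE E (D i) x) := by
    intro x
    induction x with
    | zero => simp
    | add x y hx hy => simp only [map_add, hx, hy]
    | tmul k b => rfl
  have hfe' : πE f = LinearMap.lTensor E (incM F i s s) e := hfe
  have hπf : πK (inclE E B f) = LinearMap.lTensor K (incM F i s s)
      (w * LinearMap.lTensor K (entM F i s t) (πK q)) := by
    rw [key3, hfe', key4, hee]
  refine ⟨E, hE, f, hf, ?_, ?_⟩
  · intro h0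
    rw [h0, map_zero] at hπf
    apply hw
    have := congrArg (LinearMap.lTensor K (entM F i s s)) hπf
    rw [map_zero, ← LinearMap.comp_apply, ← LinearMap.lTensor_comp] at this
    have hcomp : entM F i s s ∘ₗ incM F i s s = LinearMap.id (R := F) (M := D i) := by
      ext x; exact entM_incM i s s x
    rw [hcomp, LinearMap.lTensor_id] at this
    exact this.symm
  · obtain ⟨α, hα⟩ := hπK (LinearMap.lTensor K (incM F i s s) w)
    obtain ⟨β, hβ⟩ := hπK (LinearMap.lTensor K (incM F i t s) (1 ⊗ₜ 1))
    set g := inclE E B f with hg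
    have hgg : g * g = g := by rw [hg, ← map_mul, hf]
    have hj : g - α * q * β ∈ TI K (Ring.jacobson B) := by
      apply ker_TI π hπ hker
      change πK _ = 0
      rw [map_sub, map_mul, map_mul, hα, hβ, key1, hπf, sub_self]
    have hn : IsNilpotent (g * (g - α * q * β) * g) :=
      TI_nilp hnil (TI_mul_right _ (TI_mul_left _ hj))
    obtain ⟨u, hu⟩ := hn.isUnit_one_sub
    refine ⟨↑u⁻¹ * g * α, β * g, ?_⟩
    have h1 : g * (α * q * β) * g = u * g := by
      rw [hu, sub_mul, one_mul, mul_assoc _ g g, hgg, mul_sub, sub_mul, hgg, hgg, sub_sub_cancel]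
    calc g = ↑u⁻¹ * (u * g) := by rw [← mul_assoc, Units.inv_mul, one_mul]
      _ = _ := by rw [← h1]; simp only [mul_assoc]

end LemmaW


section Gen

/-- `N` is an additive generator: each finitely generated module is a summand of a power of `N`. -/
def AddGen (A N : Type) [Ring A] [AddCommGroup N] [Module A N] : Prop :=
  ∀ (X : Type) [AddCommGroup X] [Module A X] [Module.Finite A X],
    ∃ (ι : Type) (_ : Fintype ι) (s : ι → X →ₗ[A] N) (t : ι → N →ₗ[A] X),
      ∀ x, ∑ j, t j (s j x) = x

lemma AddGen.pi {A N : Type} [Ring A] [AddCommGroup N] [Module A N] (h : AddGen A N) (m : ℕ) :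
    AddGen A (Fin (m+1) → N) := by
  intro X _ _ _
  obtain ⟨ι, _, s, t, hst⟩ := h X
  refine ⟨ι, inferInstance, fun j => LinearMap.single A _ 0 ∘ₗ s j,
    fun j => t j ∘ₗ LinearMap.proj 0, fun x => ?_⟩
  simpa using hst x

lemma addGen_aux {F A N : Type} [Field F] [Ring A] [Algebra F A] [FiniteDimensional F A]
    [AddCommGroup N] [Module A N]
    (h : ∀ (X : Type) [AddCommGroup X] [Module A X] [Module.Finite A X],
      IsIndecomposableModule A X → ∃ (s : X →ₗ[A] N) (t : N →ₗ[A] X), ∀ x, t (s x) = x) (n : ℕ) :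
    ∀ (X : Type) [AddCommGroup X] [Module A X] [Module F X] [IsScalarTower F A X]
      [Module.Finite F X], Module.finrank F X = n →
    ∃ (ι : Type) (_ : Fintype ι) (s : ι → X →ₗ[A] N) (t : ι → N →ₗ[A] X),
      ∀ x, ∑ j, t j (s j x) = x := by
  induction n using Nat.strong_induction_on with
  | _ n ih =>
  intro X _ _ _ _ _ hX
  rcases subsingleton_or_nontrivial X with hs | hs
  · exact ⟨Empty, inferInstance, fun j => j.elim, fun j => j.elim, fun x => Subsingleton.elim _ _⟩
  by_cases hind : IsIndecomposableModule A X
  · have : Module.Finite A X := Module.Finite.of_restrictScalars_finite F A X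
    obtain ⟨s, t, hst⟩ := h X hind
    exact ⟨Unit, inferInstance, fun _ => s, fun _ => t, fun x => by simpa using hst x⟩
  · have : ∃ P Q : Submodule A X, IsCompl P Q ∧ P ≠ ⊥ ∧ Q ≠ ⊥ := by
      by_contra! hcon
      apply hind
      refine ⟨hs, fun P Q hPQ => ?_⟩
      by_contra! h2
      exact h2.2 (hcon P Q hPQ h2.1)
    obtain ⟨P, Q, hPQ, hP, hQ⟩ := this
    have lt : ∀ P Q : Submodule A X, IsCompl P Q → Q ≠ ⊥ → Module.finrank F P < n := by
      intro P Q hPQ hQ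
      rw [← hX]
      have hne : P.restrictScalars F < ⊤ := by
        rw [lt_top_iff_ne_top]
        intro htop
        apply hQ
        have : P = ⊤ := by
          rw [Submodule.eq_top_iff']
          intro x
          have : x ∈ P.restrictScalars F := by rw [htop]; trivial
          exact this
        rw [← top_inf_eq Q, ← this, hPQ.inf_eq_bot]
      exact Submodule.finrank_lt hne.ne
    have : Module.Finite F P := inferInstanceAs (Module.Finite F (P.restrictScalars F))
    have : Module.Finite F Q := inferInstanceAs (Module.Finite F (Q.restrictScalars F))
    obtain ⟨ι, _, s, t, hst⟩ := ih _ (lt P Q hPQ hQ) P rfl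
    obtain ⟨ι', _, s', t', hst'⟩ := ih _ (lt Q P hPQ.symm hP) Q rfl
    let e := Submodule.prodEquivOfIsCompl P Q hPQ
    refine ⟨ι ⊕ ι', inferInstance,
      Sum.elim (fun j => s j ∘ₗ LinearMap.fst A P Q ∘ₗ e.symm.toLinearMap)
        (fun j => s' j ∘ₗ LinearMap.snd A P Q ∘ₗ e.symm.toLinearMap),
      Sum.elim (fun j => P.subtype ∘ₗ t j) (fun j => Q.subtype ∘ₗ t' j), fun x => ?_⟩
    rw [Fintype.sum_sum_type]
    simp only [Sum.elim_inl, Sum.elim_inr, LinearMap.comp_apply, ← map_sum]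
    rw [hst, hst']
    exact e.apply_symm_apply x

lemma exists_generator (F : Type) {A : Type} [Field F] [Ring A] [Algebra F A] [FiniteDimensional F A]
    (hfrt : FiniteRepType A) : ∃ (N : Type) (_ : AddCommGroup N) (_ : Module A N) (_ : Module F N)
      (_ : IsScalarTower F A N) (_ : Module.Finite F N), AddGen A N := by
  obtain ⟨S, hS, hSM⟩ := hfrt
  let S' : Set (ModuleCat.{0} A) := {M | M ∈ S ∧ Module.Finite A M}
  have hS' : Finite S' := hS.subset (fun M h => h.1)
  obtain ⟨n, ⟨e⟩⟩ := Finite.exists_equiv_fin S'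
  let N := (i : Fin n) → (e.symm i).1
  have hfin : ∀ i, Module.Finite A (e.symm i).1 := fun i => (e.symm i).2.2
  have hN : Module.Finite A N := inferInstance
  letI : Module F N := Module.compHom N (algebraMap F A)
  have htow : IsScalarTower F A N := by
    refine IsScalarTower.of_algebraMap_smul fun r x => rfl
  have hNF : Module.Finite F N := Module.Finite.trans A N
  refine ⟨N, inferInstance, inferInstance, inferInstance, htow, hNF, ?_⟩
  intro X _ _ _
  letI : Module F X := Module.compHom X (algebraMap F A)
  have htow : IsScalarTower F A X := by
    refine IsScalarTower.of_algebraMap_smul fun r x => rfl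
  have hNF : Module.Finite F X := Module.Finite.trans A X
  refine addGen_aux (F := F) (N := N) ?_ _ X rfl
  intro Y _ _ hY hYi
  obtain ⟨Z, hZ, ⟨f⟩⟩ := hSM (ModuleCat.of A Y) hY hYi
  have hZf : Module.Finite A Z := Module.Finite.equiv f
  obtain ⟨i, hi⟩ := e.symm.surjective ⟨Z, hZ, hZf⟩
  have hi' : (e.symm i).1 = Z := congrArg Subtype.val hi
  subst hi'
  refine ⟨LinearMap.single A (fun i => (e.symm i).1) i ∘ₗ f.toLinearMap,
    f.symm.toLinearMap ∘ₗ LinearMap.proj i, fun x => ?_⟩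
  have h1 : (LinearMap.proj i : ((j : Fin n) → (e.symm j).1) →ₗ[A] _)
      (LinearMap.single A (fun i => (e.symm i).1) i (f x)) = f x := Pi.single_eq_same _ _
  exact (congrArg f.symm h1).trans (f.symm_apply_apply x)

end Gen


section Act

variable {F K A N : Type} [Field F] [Field K] [Algebra F K] [Ring A] [Algebra F A]

/-- The action of `B` on the base change of `N`. -/
noncomputable def aN (F K A N : Type) [Field F] [Field K] [Algebra F K] [Ring A] [Algebra F A]
    [AddCommGroup N] [Module F N] [Module A N] [IsScalarTower F A N] :
    A →ₐ[F] Module.End K (K ⊗[F] N) :=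
  (Module.End.baseChangeHom F K N).comp (Algebra.lsmul F F N)

/-- `A`-equivariant `K`-linear maps. -/
def IsHom {Q Q' : Type} [AddCommGroup Q] [Module K Q] [Module F Q] [IsScalarTower F K Q]
    [AddCommGroup Q'] [Module K Q'] [Module F Q'] [IsScalarTower F K Q']
    (α : A →ₐ[F] Module.End K Q) (β : A →ₐ[F] Module.End K Q') (u : Q →ₗ[K] Q') : Prop :=
  ∀ a q, u (α a q) = β a (u q)

variable [AddCommGroup N] [Module F N] [Module A N] [IsScalarTower F A N]

lemma aN_tmul (a : A) (k : K) (n : N) : aN F K A N a (k ⊗ₜ n) = k ⊗ₜ (a • n) := by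
  rfl

/-- The base-changed action of the endomorphism ring. -/
noncomputable def Phi (F K A N : Type) [Field F] [Field K] [Algebra F K] [Ring A] [Algebra F A]
    [AddCommGroup N] [Module F N] [Module A N] [IsScalarTower F A N] :
    K ⊗[F] Module.End A N →ₐ[K] Module.End K (K ⊗[F] N) :=
  Algebra.TensorProduct.lift (Algebra.ofId K _)
    ((Module.End.baseChangeHom F K N).comp (Algebra.lsmul F F N))
    (fun k b => by
      rw [Algebra.ofId_apply]
      exact Algebra.commute_algebraMap_left k _)

lemma Phi_tmul (k k' : K) (l : Module.End A N) (n : N) :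
    Phi F K A N (k ⊗ₜ l) (k' ⊗ₜ n) = (k * k') ⊗ₜ (l n) := by
  have h : (Module.End.baseChangeHom F K N) ((Algebra.lsmul F F N) l) (k' ⊗ₜ[F] n)
    = k' ⊗ₜ l n := rfl
  rw [Phi, Algebra.TensorProduct.lift_tmul, Algebra.ofId_apply, Module.End.mul_apply,
    Module.algebraMap_end_apply]
  change k • ((Module.End.baseChangeHom F K N) ((Algebra.lsmul F F N) l) (k' ⊗ₜ[F] n)) = _
  rw [h, TensorProduct.smul_tmul', smul_eq_mul]

/-- base change of `A`-linear maps -/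
noncomputable def bc (F K : Type) {A N N' : Type} [Field F] [Field K] [Algebra F K] [Ring A] [Algebra F A]
    [AddCommGroup N] [Module F N] [Module A N] [IsScalarTower F A N]
    [AddCommGroup N'] [Module F N'] [Module A N'] [IsScalarTower F A N']
    (g : N →ₗ[A] N') : K ⊗[F] N →ₗ[K] K ⊗[F] N' :=
  (g.restrictScalars F).baseChange K

variable {N' N'' : Type} [AddCommGroup N'] [Module F N'] [Module A N'] [IsScalarTower F A N']
  [AddCommGroup N''] [Module F N''] [Module A N''] [IsScalarTower F A N'']

@[simp] lemma bc_tmul (g : N →ₗ[A] N') (k : K) (n : N) : bc F K g (k ⊗ₜ n) = k ⊗ₜ (g n) := by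
  simp [bc]

lemma bc_isHom (g : N →ₗ[A] N') : IsHom (aN F K A N) (aN F K A N') (bc F K g) := by
  intro a q
  induction q using TensorProduct.induction_on with
  | zero => simp
  | tmul k n => simp [aN_tmul]
  | add x y hx hy => simp only [map_add, hx, hy]

lemma bc_comp (g : N →ₗ[A] N') (h : N' →ₗ[A] N'') (q : K ⊗[F] N) :
    bc F K h (bc F K g q) = bc F K (h ∘ₗ g) q := by
  induction q using TensorProduct.induction_on with
  | zero => simp
  | tmul k n => simp
  | add x y hx hy => simp only [map_add, hx, hy]

lemma bc_sum {ι : Type} [Fintype ι] (g : ι → N →ₗ[A] N') (q : K ⊗[F] N) :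
    bc F K (∑ j, g j) q = ∑ j, bc F K (g j) q := by
  induction q using TensorProduct.induction_on with
  | zero => simp
  | tmul k n => simp [LinearMap.sum_apply, TensorProduct.tmul_sum]
  | add x y hx hy => simp only [map_add, hx, hy, Finset.sum_add_distrib]

lemma bc_id (q : K ⊗[F] N) : bc F K (LinearMap.id : N →ₗ[A] N) q = q := by
  simp only [bc]
  exact LinearMap.congr_fun (LinearMap.baseChange_id) q

lemma Phi_one_tmul (l : Module.End A N) : Phi F K A N (1 ⊗ₜ l) = bc F K l := by
  ext n
  simp [Phi_tmul]

lemma IsHom.comp {Q Q' Q'' : Type} [AddCommGroup Q] [Module K Q] [Module F Q] [IsScalarTower F K Q]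
    [AddCommGroup Q'] [Module K Q'] [Module F Q'] [IsScalarTower F K Q']
    [AddCommGroup Q''] [Module K Q''] [Module F Q''] [IsScalarTower F K Q'']
    {α : A →ₐ[F] Module.End K Q} {β : A →ₐ[F] Module.End K Q'} {γ : A →ₐ[F] Module.End K Q''}
    {v : Q' →ₗ[K] Q''} {u : Q →ₗ[K] Q'} (hv : IsHom β γ v) (hu : IsHom α β u) :
    IsHom α γ (v ∘ₗ u) := by
  intro a q
  simp only [LinearMap.comp_apply]
  rw [hu, hv]

lemma Phi_isHom (y : K ⊗[F] Module.End A N) : IsHom (aN F K A N) (aN F K A N) (Phi F K A N y) := by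
  intro a q
  induction y using TensorProduct.induction_on with
  | zero => simp
  | tmul k l =>
    induction q using TensorProduct.induction_on with
    | zero => simp
    | tmul k n => simp [aN_tmul, Phi_tmul]
    | add x y hx hy => simp only [map_add, hx, hy]
  | add x y hx hy => simp only [map_add, LinearMap.add_apply, hx, hy]

/-- coordinates -/
noncomputable def kap {ι : Type} (c : Module.Basis ι F K) (j : ι) : K ⊗[F] N →ₗ[F] N :=
  (TensorProduct.lid F N).toLinearMap ∘ₗ (c.coord j).rTensor N

lemma kap_tmul {ι : Type} (c : Module.Basis ι F K) (j : ι) (k : K) (n : N) :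
    kap c j (k ⊗ₜ[F] n) = c.repr k j • n := by
  simp [kap]

lemma kap_exists {ι : Type} (c : Module.Basis ι F K) (x : K ⊗[F] N) :
    ∃ S : Finset ι, ∀ T, S ⊆ T → x = ∑ j ∈ T, c j ⊗ₜ kap c j x := by
  classical
  induction x using TensorProduct.induction_on with
  | zero => exact ⟨∅, by simp⟩
  | tmul k n =>
    refine ⟨(c.repr k).support, fun T hT => ?_⟩
    simp only [kap_tmul, TensorProduct.tmul_smul, TensorProduct.smul_tmul']
    rw [← TensorProduct.sum_tmul]
    congr 1
    conv_lhs => rw [← c.linearCombination_repr k, Finsupp.linearCombination_apply]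
    rw [Finsupp.sum_of_support_subset _ hT _ (by simp)]
  | add x y hx hy =>
    obtain ⟨S, hS⟩ := hx
    obtain ⟨S', hS'⟩ := hy
    refine ⟨S ∪ S', fun T hT => ?_⟩
    simp only [map_add, TensorProduct.tmul_add, Finset.sum_add_distrib]
    rw [← hS T (Finset.union_subset_left hT), ← hS' T (Finset.union_subset_right hT)]

lemma kap_aN {ι : Type} (c : Module.Basis ι F K) (j : ι) (a : A) (x : K ⊗[F] N) :
    kap c j (aN F K A N a x) = a • kap c j x := by
  induction x using TensorProduct.induction_on with
  | zero => simp
  | tmul k n =>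
    simp only [aN_tmul, kap_tmul]
    exact smul_comm _ _ _
  | add x y hx hy => simp only [map_add, hx, hy, smul_add]

lemma Phi_surj [Module.Finite F N] (h : Module.End K (K ⊗[F] N))
    (hh : IsHom (aN F K A N) (aN F K A N) h) : ∃ y, Phi F K A N y = h := by
  classical
  let c := Module.Free.chooseBasis F K
  let l : Module.Free.ChooseBasisIndex F K → Module.End A N := fun j =>
    { toFun := fun n => kap c j (h (1 ⊗ₜ n))
      map_add' := fun x y => by simp only [TensorProduct.tmul_add, map_add]
      map_smul' := fun a x => by
        simp only [RingHom.id_apply]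
        rw [← kap_aN, ← hh, aN_tmul] }
  let b := Module.finBasis F N
  choose S hS using fun i => kap_exists c (h (1 ⊗ₜ b i))
  let T := Finset.univ.biUnion S
  refine ⟨∑ j ∈ T, c j ⊗ₜ l j, ?_⟩
  have key : (TensorProduct.mk F K N 1).range ≤ LinearMap.eqLocus
      ((Phi F K A N (∑ j ∈ T, c j ⊗ₜ l j)).restrictScalars F) (h.restrictScalars F) := by
    rw [LinearMap.range_eq_map, ← b.span_eq, Submodule.map_span, Submodule.span_le]
    rintro _ ⟨_, ⟨i, rfl⟩, rfl⟩
    simp only [TensorProduct.mk_apply, SetLike.mem_coe, LinearMap.mem_eqLocus, LinearMap.coe_restrictScalars]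
    rw [hS i T (Finset.subset_biUnion_of_mem S (Finset.mem_univ i)), map_sum, LinearMap.sum_apply]
    refine Finset.sum_congr rfl fun j _ => ?_
    rw [Phi_tmul, mul_one]
    rfl
  ext n
  exact key ⟨n, rfl⟩

end Act


section Cogen

/-- The dual of `A` with its left `A`-action. -/
def DualA (F A : Type) [Field F] [Ring A] [Algebra F A] : Type := A →ₗ[F] F

variable {F K A N : Type} [Field F] [Field K] [Algebra F K] [Ring A] [Algebra F A]

noncomputable instance : AddCommGroup (DualA F A) := inferInstanceAs (AddCommGroup (A →ₗ[F] F))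
noncomputable instance : Module F (DualA F A) := inferInstanceAs (Module F (A →ₗ[F] F))
instance [FiniteDimensional F A] : Module.Finite F (DualA F A) :=
  inferInstanceAs (Module.Finite F (A →ₗ[F] F))

/-- evaluation -/
def evA (y : A) : DualA F A →ₗ[F] F := LinearMap.applyₗ (R := F) (M := A) (M₂ := F) y

lemma DualA.ext' {f g : DualA F A} (h : ∀ y, evA y f = evA y g) : f = g := LinearMap.ext h

noncomputable instance : SMul A (DualA F A) :=
  ⟨fun a f => (LinearMap.comp (f : A →ₗ[F] F) (LinearMap.mulRight F a) : A →ₗ[F] F)⟩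

lemma evA_smul (a y : A) (f : DualA F A) : evA y (a • f) = evA (y * a) f := rfl

lemma evA_mul_add (y z : A) (f : DualA F A) : evA (y + z) f = evA y f + evA z f :=
  LinearMap.map_add (M := A) (M₃ := F) f y z

lemma evA_mul_smul (r : F) (z : A) (f : DualA F A) : evA (r • z) f = r * evA z f :=
  LinearMap.map_smul (M := A) (M₂ := F) f r z

noncomputable instance : Module A (DualA F A) where
  one_smul f := DualA.ext' fun y => by rw [evA_smul, mul_one]
  mul_smul a b f := DualA.ext' fun y => by simp only [evA_smul, mul_assoc]
  smul_zero a := DualA.ext' fun y => by rw [evA_smul, map_zero, map_zero]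
  smul_add a f g := DualA.ext' fun y => by simp only [evA_smul, map_add]
  add_smul a b f := DualA.ext' fun y => by
    simp only [evA_smul, map_add, mul_add, evA_mul_add]
  zero_smul f := DualA.ext' fun y => by
    have := evA_mul_smul (0 : F) y f
    rw [zero_smul, zero_mul] at this
    rw [evA_smul, mul_zero, this, map_zero]

instance : IsScalarTower F A (DualA F A) where
  smul_assoc r a f := DualA.ext' fun y => by
    rw [evA_smul, mul_smul_comm, evA_mul_smul, map_smul, evA_smul, smul_eq_mul]

instance [FiniteDimensional F A] : Module.Finite A (DualA F A) :=
  Module.Finite.of_restrictScalars_finite F A _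

/-- base-changed evaluation -/
noncomputable def evK (K : Type) [Field K] [Algebra F K] (y : A) : K ⊗[F] DualA F A →ₗ[K] K :=
  (TensorProduct.AlgebraTensorModule.rid F K K).toLinearMap ∘ₗ (evA y).baseChange K

lemma evK_tmul (y : A) (k : K) (f : DualA F A) : evK K y (k ⊗ₜ f) = evA y f • k := by
  simp [evK]

lemma evK_aN (y a : A) (x : K ⊗[F] DualA F A) :
    evK K y (aN F K A _ a x) = evK K (y * a) x := by
  induction x using TensorProduct.induction_on with
  | zero => simp
  | tmul k f => rw [aN_tmul, evK_tmul, evK_tmul, evA_smul]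
  | add x y hx hy => simp only [map_add, hx, hy]

lemma evK_ext [FiniteDimensional F A] (x x' : K ⊗[F] DualA F A)
    (h : ∀ y, evK K y x = evK K y x') : x = x' := by
  classical
  let b := Module.finBasis F A
  let bs : Fin (Module.finrank F A) → DualA F A := fun i => b.coord i
  have key : ∀ x : K ⊗[F] DualA F A, x = ∑ i, evK K (b i) x ⊗ₜ bs i := by
    intro x
    induction x using TensorProduct.induction_on with
    | zero => simp
    | tmul k f =>
      simp only [evK_tmul]
      have : f = ∑ i, evA (b i) f • bs i := (b.sum_dual_apply_smul_coord f).symm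
      conv_lhs => rw [this, TensorProduct.tmul_sum]
      refine Finset.sum_congr rfl fun i _ => ?_
      rw [TensorProduct.tmul_smul, TensorProduct.smul_tmul']
    | add x y hx hy =>
      simp only [map_add, TensorProduct.add_tmul, Finset.sum_add_distrib]
      rw [← hx, ← hy]
  rw [key x, key x']
  simp only [h]

lemma cogen [FiniteDimensional F A] [AddCommGroup N] [Module F N] [Module A N] [IsScalarTower F A N]
    (hgen : AddGen A N) {Q : Type} [AddCommGroup Q] [Module K Q] [Module F Q] [IsScalarTower F K Q]
    (α : A →ₐ[F] Module.End K Q) (W : Submodule K Q) (hW : ∀ a, ∀ q ∈ W, α a q ∈ W)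
    (x : Q) (hx : x ∉ W) : ∃ h : Q →ₗ[K] K ⊗[F] N, IsHom α (aN F K A N) h ∧
      (∀ q ∈ W, h q = 0) ∧ h x ≠ 0 := by
  classical
  obtain ⟨φ, hφx, hφW⟩ := Submodule.exists_dual_map_eq_bot_of_notMem hx inferInstance
  have hφW' : ∀ q ∈ W, φ q = 0 := by
    intro q hq
    have : φ q ∈ W.map φ := ⟨q, hq, rfl⟩
    rwa [hφW, Submodule.mem_bot] at this
  let b := Module.finBasis F A
  let bs : Fin (Module.finrank F A) → DualA F A := fun i => b.coord i
  let θ : Q →ₗ[K] K ⊗[F] DualA F A :=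
    ∑ i, (LinearMap.toSpanSingleton K _ ((1 : K) ⊗ₜ[F] bs i)) ∘ₗ φ ∘ₗ α (b i)
  have hθ : ∀ q, θ q = ∑ i, φ (α (b i) q) ⊗ₜ bs i := by
    intro q
    simp only [θ, LinearMap.sum_apply, LinearMap.comp_apply, LinearMap.toSpanSingleton_apply,
      TensorProduct.smul_tmul', smul_eq_mul, mul_one]
  have hev : ∀ y q, evK K y (θ q) = φ (α y q) := by
    intro y q
    rw [hθ, map_sum]
    simp only [evK_tmul]
    conv_rhs => rw [← b.sum_repr y]
    rw [map_sum, LinearMap.sum_apply, map_sum]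
    refine Finset.sum_congr rfl fun i _ => ?_
    rw [map_smul, LinearMap.smul_apply]
    rw [← algebraMap_smul K (b.repr y i) (α (b i) q), map_smul, algebraMap_smul]
    rfl
  have hθh : IsHom α (aN F K A _) θ := by
    intro a q
    apply evK_ext
    intro y
    rw [evK_aN, hev, hev, map_mul, Module.End.mul_apply]
  have hθx : θ x ≠ 0 := by
    intro h0
    have := hev 1 x
    rw [h0, map_zero, map_one] at this
    exact hφx this.symm
  obtain ⟨ι, _, s, t, hst⟩ := hgen (DualA F A)
  have hs : ∃ j, bc F K (s j) (θ x) ≠ 0 := by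
    by_contra! hcon
    apply hθx
    have h1 : (∑ j, t j ∘ₗ s j : DualA F A →ₗ[A] DualA F A) = LinearMap.id := by
      ext z
      rw [LinearMap.sum_apply]
      exact hst z
    rw [← bc_id (A := A) (θ x), ← h1, bc_sum]
    refine Finset.sum_eq_zero fun j _ => ?_
    rw [← bc_comp, hcon j, map_zero]
  obtain ⟨j, hj⟩ := hs
  refine ⟨bc F K (s j) ∘ₗ θ, (bc_isHom (s j)).comp hθh, fun q hq => ?_, hj⟩
  have : θ q = 0 := by
    rw [hθ]
    refine Finset.sum_eq_zero fun i _ => ?_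
    rw [hφW' _ (hW _ q hq), TensorProduct.zero_tmul]
  rw [LinearMap.comp_apply, this, map_zero]

end Cogen


section Step1

variable {F K A N : Type} [Field F] [Field K] [Algebra F K] [Ring A] [Algebra F A]
  [AddCommGroup N] [Module F N] [Module A N] [IsScalarTower F A N]

lemma finite_End [Module.Finite F N] : Module.Finite F (Module.End A N) := by
  let f : Module.End A N →ₗ[F] Module.End F N := (Algebra.lsmul F F N).toLinearMap
  refine Module.Finite.of_injective f ?_
  intro x y h
  ext n
  exact LinearMap.congr_fun h n

/-- lifting a map through the kernel -/
lemma lift_ker {N₁ : Type} [AddCommGroup N₁] [Module F N₁] [Module A N₁] [IsScalarTower F A N₁]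
    {Q : Type} [AddCommGroup Q] [Module K Q] [Module F Q] [IsScalarTower F K Q]
    (α : A →ₐ[F] Module.End K Q) (r : N₁ →ₗ[A] N) (w : Q →ₗ[K] K ⊗[F] N₁)
    (hw : IsHom α (aN F K A N₁) w) (hr : ∀ q, bc F K r (w q) = 0) :
    ∃ w' : Q →ₗ[K] K ⊗[F] (LinearMap.ker r), IsHom α (aN F K A _) w' ∧
      ∀ q, bc F K (LinearMap.ker r).subtype (w' q) = w q := by
  have hex : Function.Exact ((LinearMap.ker r).subtype.restrictScalars F) (r.restrictScalars F) := by
    intro x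
    constructor
    · intro hx
      exact ⟨⟨x, hx⟩, rfl⟩
    · rintro ⟨y, rfl⟩
      exact y.2
  have hex' := Module.Flat.lTensor_exact K hex
  have hinj : Function.Injective (bc F K (LinearMap.ker r).subtype) := by
    have := Module.Flat.lTensor_preserves_injective_linearMap (M := K)
      ((LinearMap.ker r).subtype.restrictScalars F) Subtype.val_injective
    exact this
  have hmem : ∀ q, w q ∈ LinearMap.range (bc F K (LinearMap.ker r).subtype) := by
    intro q
    obtain ⟨y, hy⟩ := (hex' (w q)).1 (hr q)
    exact ⟨y, hy⟩
  let e := LinearEquiv.ofInjective (bc F K (LinearMap.ker r).subtype) hinj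
  have he : ∀ z, bc F K (LinearMap.ker r).subtype (e.symm z) = z := fun z =>
    congrArg Subtype.val (e.apply_symm_apply z)
  let w' := e.symm.toLinearMap ∘ₗ w.codRestrict _ hmem
  have hw' : ∀ q, bc F K (LinearMap.ker r).subtype (w' q) = w q := fun q => he _
  refine ⟨w', ?_, hw'⟩
  intro a q
  apply hinj
  rw [hw', bc_isHom, hw', hw]

section

variable {Q : Type} [AddCommGroup Q] [Module K Q] [Module F Q] [IsScalarTower F K Q]
  {α : A →ₐ[F] Module.End K Q}

lemma exists_u [Module.Finite F N] [Module.Finite K Q] (hgen : AddGen A N) :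
    ∃ (m : ℕ) (u : Q →ₗ[K] K ⊗[F] (Fin (m+1) → N)), IsHom α (aN F K A _) u ∧
      ∀ h : Q →ₗ[K] K ⊗[F] (Fin (m+1) → N), IsHom α (aN F K A _) h →
        ∃ y, ∀ q, h q = Phi F K A _ y (u q) := by
  classical
  let H : Submodule K (Q →ₗ[K] K ⊗[F] N) :=
    { carrier := {h | IsHom α (aN F K A N) h}
      zero_mem' := fun a q => by simp
      add_mem' := fun {x y} hx hy a q => by
        simp only [LinearMap.add_apply, map_add, hx a q, hy a q]
      smul_mem' := fun c x hx a q => by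
        simp only [LinearMap.smul_apply, map_smul, hx a q] }
  have hH : H.FG := IsNoetherian.noetherian H
  obtain ⟨m, s, hs⟩ := Submodule.fg_iff_exists_fin_generating_family.1 hH
  let s' : Fin (m+1) → (Q →ₗ[K] K ⊗[F] N) := Fin.cons 0 s
  have hs' : Submodule.span K (Set.range s') = H := by
    simp only [s', Fin.range_cons, Submodule.span_insert_zero, hs]
  have hsH : ∀ i, IsHom α (aN F K A N) (s' i) := by
    intro i
    have : s' i ∈ H := by rw [← hs']; exact Submodule.subset_span ⟨i, rfl⟩
    exact this
  let u : Q →ₗ[K] K ⊗[F] (Fin (m+1) → N) :=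
    ∑ i, bc F K (LinearMap.single A (fun _ => N) i) ∘ₗ s' i
  have hu : ∀ q, u q = ∑ i, bc F K (LinearMap.single A (fun _ => N) i) (s' i q) := by
    intro q; simp [u, LinearMap.sum_apply]
  have hproj : ∀ j q, bc F K (LinearMap.proj (R := A) (φ := fun _ : Fin (m+1) => N) j) (u q)
      = s' j q := by
    intro j q
    rw [hu, map_sum, Finset.sum_eq_single j]
    · rw [bc_comp]
      conv_rhs => rw [← bc_id (A := A) (s' j q)]
      congr 2
      ext; simp
    · intro i _ hij
      rw [bc_comp]
      have : LinearMap.proj (R := A) (φ := fun _ : Fin (m+1) => N) j ∘ₗ LinearMap.single A (fun _ => N) i = 0 := by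
        ext; simp [hij.symm]
      rw [this]
      simp [bc]
    · simp
  refine ⟨m, u, ?_, ?_⟩
  · intro a q
    rw [hu, hu, map_sum]
    refine Finset.sum_congr rfl fun i _ => ?_
    rw [hsH, bc_isHom]
  · intro h hh
    have h1 : ∀ j, ∃ c : Fin (m+1) → K, ∑ i, c i • s' i =
        bc F K (LinearMap.proj (R := A) (φ := fun _ : Fin (m+1) => N) j) ∘ₗ h := by
      intro j
      rw [← Submodule.mem_span_range_iff_exists_fun, hs']
      exact (bc_isHom _).comp hh
    choose c hc using h1
    refine ⟨∑ j, ∑ i, c j i ⊗ₜ (LinearMap.single A (fun _ : Fin (m+1) => N) j ∘ₗ LinearMap.proj i), ?_⟩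
    intro q
    have h2 : ∀ z : K ⊗[F] (Fin (m+1) → N), z = ∑ j, bc F K (LinearMap.single A (fun _ : Fin (m+1) => N) j)
        (bc F K (LinearMap.proj (R := A) (φ := fun _ : Fin (m+1) => N) j) z) := by
      intro z
      simp only [bc_comp]
      rw [← bc_sum]
      conv_lhs => rw [← bc_id (A := A) z]
      congr 2
      ext i x k
      simp [LinearMap.sum_apply, Pi.single_apply]
    rw [h2 (h q)]
    simp only [map_sum, LinearMap.sum_apply]
    refine Finset.sum_congr rfl fun j _ => ?_
    have h3 := LinearMap.congr_fun (hc j) q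
    rw [LinearMap.comp_apply] at h3
    rw [← h3]
    simp only [LinearMap.sum_apply, map_sum, LinearMap.smul_apply, map_smul]
    refine Finset.sum_congr rfl fun i _ => ?_
    have h4 : c j i ⊗ₜ[F] (LinearMap.single A (fun _ : Fin (m+1) => N) j ∘ₗ LinearMap.proj i :
      Module.End A (Fin (m+1) → N)) = c j i • ((1 : K) ⊗ₜ[F] (LinearMap.single A (fun _ : Fin (m+1) => N) j ∘ₗ LinearMap.proj i :
      Module.End A (Fin (m+1) → N))) := by
      rw [TensorProduct.smul_tmul', smul_eq_mul, mul_one]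
    rw [h4, map_smul, LinearMap.smul_apply, Phi_one_tmul, ← bc_comp, hproj]

variable {u : Q →ₗ[K] K ⊗[F] N}

lemma exists_min_p [Module.Finite F N] : ∃ p : K ⊗[F] Module.End A N, p * p = p ∧
    (∀ q, Phi F K A N p (u q) = u q) ∧ ∀ h, h * h = h → p * h = h → h * p = h →
      (∀ q, Phi F K A N h (u q) = 0) → h = 0 := by
  classical
  have := finite_End (F := F) (A := A) (N := N)
  let S : Set (K ⊗[F] Module.End A N) := {p | p * p = p ∧ ∀ q, Phi F K A N p (u q) = u q}
  let d : K ⊗[F] Module.End A N → ℕ := fun p =>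
    Module.finrank K (LinearMap.range (LinearMap.mulLeft K p))
  have hS : S.Nonempty := ⟨1, by simp, by simp⟩
  obtain ⟨p, hp, hmin⟩ := (measure d).wf.has_min S hS
  refine ⟨p, hp.1, hp.2, fun h hh hph hhp hu => ?_⟩
  by_contra hne
  have hp1 := hp.1
  apply hmin (p - h)
  · refine ⟨?_, fun q => ?_⟩
    · rw [sub_mul, mul_sub, mul_sub, hp1, hph, hhp, hh]; abel
    · rw [map_sub, LinearMap.sub_apply, hp.2, hu, sub_zero]
  · change d (p - h) < d p
    apply Submodule.finrank_lt_finrank_of_lt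
    rw [SetLike.lt_iff_le_and_exists]
    constructor
    · rintro _ ⟨r, rfl⟩
      refine ⟨(p - h) * r, ?_⟩
      simp only [LinearMap.mulLeft_apply]
      rw [← mul_assoc, mul_sub, hp1, hph]
    · refine ⟨h, ⟨h, hph⟩, ?_⟩
      rintro ⟨r, hr⟩
      rw [LinearMap.mulLeft_apply] at hr
      apply hne
      have h1 : h * h = h * ((p - h) * r) := by rw [hr]
      rw [hh, ← mul_assoc, mul_sub, hhp, hh, sub_self, zero_mul] at h1
      exact h1

lemma V_J [Module.Finite F N] (hC1 : IsC1Field F) (hpc : PerfectlyClosedIn F K)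
    {p : K ⊗[F] Module.End A N} (hp : p * p = p)
    (hmin : ∀ h, h * h = h → p * h = h → h * p = h →
      (∀ q, Phi F K A N h (u q) = 0) → h = 0)
    {v : K ⊗[F] Module.End A N} (hv : v * p = v) (hv0 : ∀ q, Phi F K A N v (u q) = 0) :
    v ∈ TI K (Ring.jacobson (Module.End A N)) := by
  by_contra hcon
  have := finite_End (F := F) (A := A) (N := N)
  obtain ⟨E, _, e, he, hne, a, b, hab⟩ := lemmaW hC1 hpc v hcon
  have hff : inclE E _ e * inclE E _ e = inclE E _ e := by rw [← map_mul, he]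
  generalize inclE E _ e = f at hff hab hne
  have key : a * v * (p * b * f * a * v) * b = f := by
    calc _ = a * (v * p) * b * f * (a * v * b) := by simp only [mul_assoc]
      _ = f := by rw [hv, ← hab, hff, hff]
  have h0 : p * b * f * a * v = 0 := by
    apply hmin
    · calc _ = p * b * f * (a * (v * p) * b) * f * a * v := by simp only [mul_assoc]
        _ = p * b * (f * f * f) * a * v := by rw [hv, ← hab]; simp only [mul_assoc]
        _ = _ := by rw [hff, hff]
    · simp only [← mul_assoc, hp]
    · rw [mul_assoc _ v p, hv]
    · intro q
      rw [map_mul, Module.End.mul_apply, hv0, map_zero]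
  rw [h0] at key
  apply hne
  rw [← key, mul_zero, zero_mul]

lemma V_step [Module.Finite F A] [Module.Finite F N] (hgen : AddGen A N) (hu : IsHom α (aN F K A N) u)
    (hall : ∀ h : Q →ₗ[K] K ⊗[F] N, IsHom α (aN F K A N) h → ∃ y, ∀ q, h q = Phi F K A N y (u q))
    {p : K ⊗[F] Module.End A N} (hp : p * p = p) (hpu : ∀ q, Phi F K A N p (u q) = u q)
    {J I : Ideal (Module.End A N)}
    (hI : ∀ v, v * p = v → (∀ q, Phi F K A N v (u q) = 0) → v ∈ TI K I)
    {v : K ⊗[F] Module.End A N} (hv : v * p = v) (hv0 : ∀ q, Phi F K A N v (u q) = 0)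
    (hvJ : v ∈ TI K J) : v ∈ TI K (J * I) := by
  classical
  obtain ⟨n, c, g, hg⟩ := Submodule.mem_span_set'.1 hvJ
  choose r hr hr' using fun i => (g i).2
  let w : Fin n → K ⊗[F] Module.End A N := fun i => c i ⊗ₜ 1
  have hvw : v = ∑ i, (1 ⊗ₜ r i) * w i := by
    rw [← hg]
    refine Finset.sum_congr rfl fun i _ => ?_
    rw [← hr' i]
    simp only [w, Algebra.TensorProduct.tmul_mul_tmul, one_mul, mul_one, TensorProduct.smul_tmul', smul_eq_mul]
  let R : (Fin n → N) →ₗ[A] N := ∑ i, r i ∘ₗ LinearMap.proj i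
  let W : Q →ₗ[K] K ⊗[F] (Fin n → N) :=
    ∑ i, bc F K (LinearMap.single A (fun _ => N) i) ∘ₗ Phi F K A N (w i) ∘ₗ u
  have hW : ∀ q, W q = ∑ i, bc F K (LinearMap.single A (fun _ => N) i) (Phi F K A N (w i) (u q)) := by
    intro q; simp [W, LinearMap.sum_apply]
  have hproj : ∀ j q, bc F K (LinearMap.proj (R := A) (φ := fun _ : Fin n => N) j) (W q)
      = Phi F K A N (w j) (u q) := by
    intro j q
    rw [hW, map_sum, Finset.sum_eq_single j]
    · rw [bc_comp]
      conv_rhs => rw [← bc_id (A := A) (Phi F K A N (w j) (u q))]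
      congr 2
      ext; simp
    · intro i _ hij
      rw [bc_comp]
      have : LinearMap.proj (R := A) (φ := fun _ : Fin n => N) j ∘ₗ LinearMap.single A (fun _ => N) i = 0 := by
        ext; simp [hij.symm]
      rw [this]
      simp [bc]
    · simp
  have hWh : IsHom α (aN F K A _) W := by
    intro a q
    rw [hW, hW, map_sum]
    refine Finset.sum_congr rfl fun i _ => ?_
    rw [hu, Phi_isHom, bc_isHom]
  have hRW : ∀ q, bc F K R (W q) = 0 := by
    intro q
    simp only [R]
    rw [bc_sum]
    have h := hv0 q
    rw [hvw, map_sum, LinearMap.sum_apply] at h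
    rw [← h]
    refine Finset.sum_congr rfl fun i _ => ?_
    rw [← bc_comp, hproj, map_mul, Module.End.mul_apply, Phi_one_tmul]
  obtain ⟨W', hW'h, hW'⟩ := lift_ker α R W hWh hRW
  have hfin : Module.Finite A N := Module.Finite.of_restrictScalars_finite F A N
  have hker : Module.Finite A (LinearMap.ker R) := by
    have : IsNoetherianRing A := IsNoetherianRing.of_finite F A
    infer_instance
  obtain ⟨κ, _, s, t, hst⟩ := hgen (LinearMap.ker R)
  choose y hy using fun j => hall (bc F K (s j) ∘ₗ W') ((bc_isHom _).comp hW'h)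
  let τ : Fin n → κ → Module.End A N := fun i j => LinearMap.proj i ∘ₗ (LinearMap.ker R).subtype ∘ₗ t j
  let w' : Fin n → K ⊗[F] Module.End A N := fun i => (w i - ∑ j, (1 ⊗ₜ τ i j) * y j) * p
  have hw'V : ∀ i, w' i ∈ TI K I := by
    intro i
    apply hI
    · simp only [w', mul_assoc, hp]
    · intro q
      simp only [w']
      rw [map_mul, Module.End.mul_apply, hpu, map_sub, LinearMap.sub_apply, sub_eq_zero]
      rw [← hproj i q, ← hW' q, bc_comp]
      have h1 : (∑ j, t j ∘ₗ s j : LinearMap.ker R →ₗ[A] LinearMap.ker R) = LinearMap.id := by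
        ext1 z
        rw [LinearMap.sum_apply]
        exact hst z
      conv_lhs => rw [← bc_id (A := A) (W' q), ← h1, bc_sum]
      rw [map_sum, map_sum, LinearMap.sum_apply]
      refine Finset.sum_congr rfl fun j _ => ?_
      rw [map_mul, Module.End.mul_apply, Phi_one_tmul, ← hy, LinearMap.comp_apply, bc_comp, bc_comp]
      rfl
  have hfinal : v = ∑ i, (1 ⊗ₜ r i) * w' i := by
    have h2 : ∑ i, ((1 : K) ⊗ₜ[F] r i) * ∑ j, (1 ⊗ₜ τ i j) * y j = 0 := by
      simp only [Finset.mul_sum]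
      rw [Finset.sum_comm]
      refine Finset.sum_eq_zero fun j _ => ?_
      simp only [← mul_assoc, Algebra.TensorProduct.tmul_mul_tmul, one_mul]
      rw [← Finset.sum_mul, ← TensorProduct.tmul_sum]
      have : ∑ i, r i * τ i j = 0 := by
        ext z
        have := (t j z).2
        rw [LinearMap.mem_ker] at this
        simp only [R, LinearMap.sum_apply] at this
        rw [LinearMap.sum_apply]
        exact this
      rw [this, TensorProduct.tmul_zero, zero_mul]
    simp only [w', ← mul_assoc]
    rw [← Finset.sum_mul]
    simp only [mul_sub, Finset.sum_sub_distrib]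
    rw [h2, sub_zero, ← hvw, hv]
  rw [hfinal]
  refine Submodule.sum_mem _ fun i _ => ?_
  exact TI_mul (tmul_mem_TI 1 (hr i)) (hw'V i)

lemma V_zero [Module.Finite F A] [Module.Finite F N] (hC1 : IsC1Field F) (hpc : PerfectlyClosedIn F K)
    (hgen : AddGen A N) (hu : IsHom α (aN F K A N) u)
    (hall : ∀ h : Q →ₗ[K] K ⊗[F] N, IsHom α (aN F K A N) h → ∃ y, ∀ q, h q = Phi F K A N y (u q)) :
    ∃ p : K ⊗[F] Module.End A N, p * p = p ∧ (∀ q, Phi F K A N p (u q) = u q) ∧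
      ∀ v, (∀ q, Phi F K A N v (u q) = 0) → v * p = 0 := by
  obtain ⟨p, hp, hpu, hmin⟩ := exists_min_p (A := A) (u := u)
  refine ⟨p, hp, hpu, ?_⟩
  have := finite_End (F := F) (A := A) (N := N)
  have : IsArtinianRing (Module.End A N) := IsArtinianRing.of_finite F _
  have hnil : IsNilpotent (Ring.jacobson (Module.End A N)) := IsSemiprimaryRing.isNilpotent
  have key : ∀ k : ℕ, ∀ v, v * p = v → (∀ q, Phi F K A N v (u q) = 0) →
      v ∈ TI K (Ring.jacobson (Module.End A N) ^ k) := by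
    intro k
    induction k with
    | zero =>
      intro v _ _
      rw [Submodule.pow_zero, Ideal.one_eq_top]; exact TI_top v
    | succ k ih =>
      intro v hv hv0
      rw [Ideal.IsTwoSided.pow_succ]
      exact V_step hgen hu hall hp hpu ih hv hv0 (V_J hC1 hpc hp hmin hv hv0)
  obtain ⟨k, hk⟩ := hnil
  intro v hv
  have := key k (v * p) (by rw [mul_assoc, hp]) (fun q => by
    rw [map_mul, Module.End.mul_apply, hpu, hv])
  rw [hk] at this
  exact TI_bot this

lemma u_inj [Module.Finite F A] (hgen : AddGen A N)
    (hall : ∀ h : Q →ₗ[K] K ⊗[F] N, IsHom α (aN F K A N) h → ∃ y, ∀ q, h q = Phi F K A N y (u q)) :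
    Function.Injective u := by
  rw [injective_iff_map_eq_zero]
  intro x hx
  by_contra hne
  obtain ⟨h, hh, -, hhx⟩ := cogen (N := N) hgen α ⊥ (fun a q hq => by
    rw [Submodule.mem_bot] at hq ⊢; rw [hq, map_zero]) x (by simpa using hne)
  obtain ⟨y, hy⟩ := hall h hh
  exact hhx (by rw [hy, hx, map_zero])

lemma range_u [Module.Finite F A] [Module.Finite F N] (hgen : AddGen A N) (hu : IsHom α (aN F K A N) u)
    {p : K ⊗[F] Module.End A N} (hV : ∀ v, (∀ q, Phi F K A N v (u q) = 0) → v * p = 0)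
    (z : K ⊗[F] N) : Phi F K A N p z ∈ LinearMap.range u := by
  by_contra hne
  obtain ⟨h, hh, hW, hhx⟩ := cogen (N := N) hgen (aN F K A N) (LinearMap.range u) (by
    rintro a _ ⟨q, rfl⟩
    exact ⟨α a q, hu a q⟩) _ hne
  obtain ⟨y, rfl⟩ := Phi_surj h hh
  apply hhx
  have := hV y (fun q => hW _ ⟨q, rfl⟩)
  rw [← Module.End.mul_apply, ← map_mul, this, map_zero, LinearMap.zero_apply]

end

end Step1


section Step2

variable {F K A N : Type} [Field F] [Field K] [Algebra F K] [Ring A] [Algebra F A]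
  [AddCommGroup N] [Module F N] [Module A N] [IsScalarTower F A N]
  {Q : Type} [AddCommGroup Q] [Module K Q] [Module F Q] [IsScalarTower F K Q]
  {α : A →ₐ[F] Module.End K Q}

lemma step2 [Module.Finite F A] [Module.Finite F N] [Nontrivial Q]
    (hC1 : IsC1Field F) (hpc : PerfectlyClosedIn F K)
    (hgen : AddGen A N) {u : Q →ₗ[K] K ⊗[F] N} (hu : IsHom α (aN F K A N) u)
    (hall : ∀ h : Q →ₗ[K] K ⊗[F] N, IsHom α (aN F K A N) h → ∃ y, ∀ q, h q = Phi F K A N y (u q))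
    (hind : ∀ S T : Submodule K Q, (∀ a, ∀ x ∈ S, α a x ∈ S) → (∀ a, ∀ x ∈ T, α a x ∈ T) →
      IsCompl S T → S = ⊥ ∨ T = ⊥) :
    ∃ E : IntermediateField F K, FiniteDimensional F E ∧ ∃ e : E ⊗[F] Module.End A N,
      ∃ φ : Q →ₗ[K] K ⊗[F] N, IsHom α (aN F K A N) φ ∧ Function.Injective φ ∧
        (∀ q, Phi F K A N (inclE E _ e) (φ q) = φ q) ∧
        ∀ z, Phi F K A N (inclE E _ e) z ∈ LinearMap.range φ := by
  obtain ⟨p, hp, hpu, hV⟩ := V_zero hC1 hpc hgen hu hall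
  have hinj := u_inj hgen hall
  have hrange := range_u hgen hu hV
  have := finite_End (F := F) (A := A) (N := N)
  have : IsArtinianRing (Module.End A N) := IsArtinianRing.of_finite F _
  have hnil : IsNilpotent (Ring.jacobson (Module.End A N)) := IsSemiprimaryRing.isNilpotent
  have hp0 : p ≠ 0 := by
    rintro rfl
    obtain ⟨q, hq⟩ := exists_ne (0 : Q)
    apply hq
    apply hinj
    rw [← hpu q, map_zero, map_zero, LinearMap.zero_apply]
  have hpJ : p ∉ TI K (Ring.jacobson (Module.End A N)) := by
    intro hmem
    obtain ⟨k, hk⟩ := TI_nilp hnil hmem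
    have h1 : IsIdempotentElem p := hp
    rcases Nat.eq_zero_or_pos k with rfl | hpos
    · rw [pow_zero] at hk
      exact hp0 (by rw [← mul_one p, hk, mul_zero])
    · rw [← Nat.succ_pred_eq_of_pos hpos, h1.pow_succ_eq] at hk
      exact hp0 hk
  obtain ⟨E, hE, e, he, hne, a, b, hab⟩ := lemmaW hC1 hpc p hpJ
  refine ⟨E, hE, e, ?_⟩
  have hff : inclE E _ e * inclE E _ e = inclE E _ e := by rw [← map_mul, he]
  generalize inclE E _ e = f at hff hab hne
  obtain ⟨a', b', hab', hpb, hfa, hap⟩ : ∃ a' b', a' * b' = f ∧ p * b' = b' ∧ f * a' = a' ∧ a' * p = a' := by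
    refine ⟨f * a * p, p * b * f, ?_, ?_, ?_, ?_⟩
    · calc _ = f * (a * (p * p) * b) * f := by simp only [mul_assoc]
        _ = f := by rw [hp, ← hab, hff, hff]
    · simp only [← mul_assoc, hp]
    · simp only [← mul_assoc, hff]
    · rw [mul_assoc, hp]
  have hbab : b' * a' * (b' * a') = b' * a' := by
    calc _ = b' * (a' * b' * a') := by simp only [mul_assoc]
      _ = _ := by rw [hab', hfa]
  have hg0 : b' * a' ≠ 0 := by
    intro h0
    apply hne
    calc f = a' * b' * (a' * b') := by rw [hab', hff]
      _ = a' * (b' * a') * b' := by simp only [mul_assoc]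
      _ = 0 := by rw [h0, mul_zero, zero_mul]
  have hpg : p * (b' * a') = b' * a' := by rw [← mul_assoc, hpb]
  have hgp : b' * a' * p = b' * a' := by rw [mul_assoc, hap]
  have hgg : ∀ z, Phi F K A N (b' * a') (Phi F K A N (b' * a') z) = Phi F K A N (b' * a') z := by
    intro z
    rw [← Module.End.mul_apply, ← map_mul, hbab]
  have hgu : ∀ q, Phi F K A N (b' * a') (u q) = u q := by
    let S : Submodule K Q := LinearMap.ker (Phi F K A N (b' * a') ∘ₗ u)
    let T : Submodule K Q := LinearMap.eqLocus (Phi F K A N (b' * a') ∘ₗ u) u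
    have hS : ∀ x, x ∈ S ↔ Phi F K A N (b' * a') (u x) = 0 := fun x => Iff.rfl
    have hT : ∀ x, x ∈ T ↔ Phi F K A N (b' * a') (u x) = u x := fun x => Iff.rfl
    have hm : ∀ q, ∃ q', u q' = Phi F K A N (b' * a') (u q) := by
      intro q
      rw [← hpg, map_mul, Module.End.mul_apply]
      exact hrange _
    have hdec : ∀ q q', u q' = Phi F K A N (b' * a') (u q) → q - q' ∈ S := by
      intro q q' h
      rw [hS, map_sub, map_sub, h, hgg, sub_self]
    have hST : IsCompl S T := by
      constructor
      · rw [Submodule.disjoint_def]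
        intro x h1 h2
        rw [hS] at h1
        rw [hT, h1] at h2
        apply hinj
        rw [← h2, map_zero]
      · rw [codisjoint_iff, Submodule.eq_top_iff']
        intro q
        obtain ⟨q', hq'⟩ := hm q
        rw [Submodule.mem_sup]
        refine ⟨q - q', hdec q q' hq', q', ?_, sub_add_cancel _ _⟩
        rw [hT, hq', hgg]
    rcases hind S T (fun a x hx => by rw [hS] at hx ⊢; rw [hu, Phi_isHom, hx, map_zero])
      (fun a x hx => by rw [hT] at hx ⊢; rw [hu, Phi_isHom, hx]) hST with h | h
    · intro q
      obtain ⟨q', hq'⟩ := hm q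
      have := hdec q q' hq'
      rw [h, Submodule.mem_bot, sub_eq_zero] at this
      rw [← hq', this]
    · exfalso
      apply hg0
      rw [← hgp]
      apply hV
      intro q
      obtain ⟨q', hq'⟩ := hm q
      have : q' ∈ T := by rw [hT, hq', hgg]
      rw [h, Submodule.mem_bot] at this
      rw [← hq', this, map_zero]
  refine ⟨Phi F K A N a' ∘ₗ u, (Phi_isHom a').comp hu, ?_, ?_, ?_⟩
  · intro x y hxy
    apply hinj
    rw [← hgu x, ← hgu y, map_mul, Module.End.mul_apply, Module.End.mul_apply]
    exact congrArg _ hxy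
  · intro q
    rw [LinearMap.comp_apply, ← Module.End.mul_apply, ← map_mul, hfa]
  · intro z
    obtain ⟨q, hq⟩ := hrange (Phi F K A N b' z)
    refine ⟨q, ?_⟩
    rw [LinearMap.comp_apply, hq]
    simp only [← Module.End.mul_apply, ← map_mul]
    rw [hpb, hab']

lemma repr_tmul {ι : Type} (b : Module.Basis ι F N) (k : K) (n : N) (i : ι) :
    (b.baseChange K).repr (k ⊗ₜ n) i = k * algebraMap F K (b.repr n i) := by
  rw [Module.Basis.baseChange_repr_tmul, Algebra.smul_def, mul_comm]

lemma step3 [Module.Finite F N] (E : IntermediateField F K) (e : E ⊗[F] Module.End A N)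
    (φ : Q →ₗ[K] K ⊗[F] N) (hφ : IsHom α (aN F K A N) φ) (hinj : Function.Injective φ)
    (h1 : ∀ q, Phi F K A N (inclE E _ e) (φ q) = φ q)
    (h2 : ∀ z, Phi F K A N (inclE E _ e) z ∈ LinearMap.range φ) :
    ∃ N₀ : Submodule E Q, (∀ a, ∀ x ∈ N₀, α a x ∈ N₀) ∧ IsBaseChange K N₀.subtype := by
  classical
  let b := Module.finBasis F N
  let bK := b.baseChange K
  let N₀ : Submodule E Q :=
    { carrier := {q | ∀ i, bK.repr (φ q) i ∈ E}
      zero_mem' := fun i => by simp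
      add_mem' := fun {x y} hx hy i => by
        rw [map_add, map_add, Finsupp.add_apply]; exact add_mem (hx i) (hy i)
      smul_mem' := fun c x hx i => by
        have : c • x = (c : K) • x := rfl
        rw [this, map_smul, map_smul, Finsupp.smul_apply, smul_eq_mul]
        exact mul_mem c.2 (hx i) }
  have hN₀ : ∀ q, q ∈ N₀ ↔ ∀ i, bK.repr (φ q) i ∈ E := fun q => Iff.rfl
  have hspan : ∀ q, q ∈ Submodule.span K (N₀ : Set Q) := by
    have key : ∀ z, Phi F K A N (inclE E _ e) z ∈ (Submodule.span K (N₀ : Set Q)).map φ := by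
      intro z
      induction z using TensorProduct.induction_on with
      | zero => rw [map_zero]; exact zero_mem _
      | add x y hx hy => rw [map_add]; exact add_mem hx hy
      | tmul k n =>
        have : k ⊗ₜ[F] n = k • ((1 : K) ⊗ₜ[F] n) := by
          rw [TensorProduct.smul_tmul', smul_eq_mul, mul_one]
        rw [this, map_smul]
        refine Submodule.smul_mem _ _ ?_
        obtain ⟨q, hq⟩ := h2 ((1 : K) ⊗ₜ[F] n)
        refine ⟨q, Submodule.subset_span ?_, hq⟩
        rw [SetLike.mem_coe, hN₀, hq]
        intro i
        clear h1 h2 hq this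
        induction e using TensorProduct.induction_on with
        | zero => simp
        | add x y hx hy =>
          rw [map_add, map_add, LinearMap.add_apply, map_add, Finsupp.add_apply]
          exact add_mem hx hy
        | tmul c l =>
          rw [inclE_tmul, Phi_tmul, repr_tmul, mul_one]
          exact mul_mem c.2 (algebraMap_mem E _)
    intro q
    obtain ⟨q', hq', h⟩ := key (φ q)
    rw [h1] at h
    rwa [← hinj h]
  refine ⟨N₀, ?_, ?_⟩
  · intro a x hx i
    rw [hφ]
    have hz := bK.sum_repr (φ x)
    rw [← hz, map_sum, map_sum, Finsupp.finset_sum_apply]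
    refine sum_mem fun j _ => ?_
    rw [map_smul, map_smul, Finsupp.smul_apply, smul_eq_mul]
    refine mul_mem (hx j) ?_
    have : bK j = 1 ⊗ₜ b j := Module.Basis.baseChange_apply ..
    rw [this, aN_tmul, repr_tmul, one_mul]
    exact algebraMap_mem E _
  · let c := Module.Free.chooseBasis E N₀
    let coordE : Module.Free.ChooseBasisIndex E N₀ → Fin (Module.finrank F N) → E :=
      fun j i => ⟨bK.repr (φ (c j)) i, (c j).2 i⟩
    have hcoordE : LinearIndependent E coordE := by
      rw [linearIndependent_iff']
      intro s g hg
      have hc := linearIndependent_iff'.1 c.linearIndependent s g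
      apply hc
      apply Subtype.ext
      apply hinj
      apply bK.repr.injective
      ext i
      have := congrArg Subtype.val (congrFun hg i)
      have hsum : ((∑ j ∈ s, g j • c j : N₀) : Q) = ∑ j ∈ s, (g j : K) • ((c j : N₀) : Q) := by
        rw [Submodule.coe_sum]
        rfl
      rw [hsum, map_sum, map_sum, Finsupp.finset_sum_apply]
      simp only [map_smul, Finsupp.smul_apply, smul_eq_mul]
      rw [Finset.sum_apply] at this
      have h3 : ((∑ j ∈ s, (g j • coordE j) i : E) : K) = ∑ j ∈ s, (g j : K) * bK.repr (φ (c j)) i := by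
        rw [← IntermediateField.coe_val, map_sum]
        rfl
      rw [h3] at this
      rw [this]
      simp
    have hK : LinearIndependent K (fun j => ((c j : N₀) : Q)) := by
      have h4 := (linearIndependent_algebraMap_comp_iff (S := K)).2 hcoordE
      let L : Q →ₗ[K] (Fin (Module.finrank F N) → K) := bK.equivFun.toLinearMap ∘ₗ φ
      refine LinearIndependent.of_comp L ?_
      have h8 : (L ∘ fun j => ((c j : N₀) : Q)) = fun j => algebraMap E K ∘ coordE j := by
        funext j i
        simp only [L, Function.comp_apply, LinearMap.comp_apply]
        exact congrFun (bK.equivFun_apply (φ (c j))) i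
      rw [h8]
      exact h4
    have hsp : ⊤ ≤ Submodule.span K (Set.range (fun j => ((c j : N₀) : Q))) := by
      intro q _
      refine Submodule.span_le.2 ?_ (hspan q)
      intro x hx
      have hx' := c.mem_span ⟨x, hx⟩
      have h5 := Submodule.mem_map_of_mem (f := N₀.subtype) hx'
      rw [Submodule.map_span, ← Set.range_comp] at h5
      exact Submodule.span_le_restrictScalars E K _ h5
    let c' := Module.Basis.mk hK hsp
    refine IsBaseChange.of_equiv ((c.baseChange K).equiv c' (Equiv.refl _)) ?_
    intro x
    generalize hG : (c.baseChange K).equiv c' (Equiv.refl _) = G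
    have h7 : ∀ j, G ((1 : K) ⊗ₜ[E] c j) = c j := by
      intro j
      have h7 : (1 : K) ⊗ₜ[E] c j = c.baseChange K j := (Module.Basis.baseChange_apply ..).symm
      rw [h7, ← hG, Module.Basis.equiv_apply, Module.Basis.mk_apply]
      rfl
    have hx := c.mem_span x
    induction hx using Submodule.span_induction with
    | mem x hx =>
      obtain ⟨j, rfl⟩ := hx
      exact h7 j
    | zero => rw [TensorProduct.tmul_zero, map_zero, map_zero]
    | add x y _ _ hx hy => rw [TensorProduct.tmul_add, map_add, hx, hy, map_add]
    | smul r x _ hx =>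
      have h9 : (1 : K) ⊗ₜ[E] (r • x) = (r : K) • ((1 : K) ⊗ₜ[E] x) := by
        rw [← TensorProduct.smul_tmul, TensorProduct.smul_tmul', smul_eq_mul, mul_one,
          Algebra.smul_def, mul_one]
        rfl
      rw [h9, map_smul, hx, map_smul]
      rfl

end Step2

/-- **Theorem 4.1(a).** Let `F` be a `C₁`-field, `A` a
finite-dimensional `F`-algebra of finite representation type, and `K/F` a field
extension in which `F` is perfectly closed.  Then every indecomposable finitely
generated `A_K`-module descends to an intermediate field `E` with `[E : F] < ∞`. -/
theorem indecomposable_descends_to_finite_subextension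
    (F K A : Type) [Field F] [Field K] [Algebra F K]
    [Ring A] [Algebra F A] [FiniteDimensional F A]
    (hC1 : IsC1Field F) (hfrt : FiniteRepType A) (hpc : PerfectlyClosedIn F K)
    (M : Type) [AddCommGroup M] [Module F M] [Module K M] [Module A M]
    [IsScalarTower F K M] [IsScalarTower F A M] [SMulCommClass K A M]
    [Module.Finite K M] (hM : IsIndecomposableAK K A M) :
    ∃ E : IntermediateField F K, FiniteDimensional F E ∧ DescendsTo F K A M E := by
  obtain ⟨N, _, _, _, _, _, hgen⟩ := exists_generator F hfrt
  have : SMulCommClass A K M := SMulCommClass.symm _ _ _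
  obtain ⟨m, u, hu, hall⟩ := exists_u (α := Algebra.lsmul F K M) hgen
  obtain ⟨hnt, hind⟩ := hM
  obtain ⟨E, hE, e, φ, hφ, hinj, h1, h2⟩ := step2 hC1 hpc (hgen.pi m) hu hall
    (fun S T hS hT hST => hind S T hS hT hST)
  obtain ⟨N₀, hN₀, hbc⟩ := step3 E e φ hφ hinj h1 h2
  exact ⟨E, hE, N₀, fun a x hx => hN₀ a x hx, hbc⟩
end
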